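/- Fix a random ordered graph I-script in the language L2 = {R2, <} with underlying order I, and random ordered graphs M_i (i in I) in the language L1 = {R1, <}. Let R = I-script_{i in I}(M_i) be the semi-direct product structure (in language {E, R1, R2, <}) and let O be the reduct of R to the language {E, <}. Then a complete first-order theory T is NIP if and only if every R-indexed indiscernible set in a sufficiently saturated model of T is an O-indexed indiscernible set. -/

import Mathlib

open FirstOrder FirstOrder.Language FirstOrder.Language.Structure CategoryTheory

namespace SRPaper

/-- Two tuples from `M` have the same complete quantifier-free type:
they satisfy the same quantifier-free formulas. -/
def SameQfTp (L : Language) (M : Type*) [L.Structure M] {n : ℕ} (a b : Fin n → M) : Prop :=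
  ∀ φ : L.Formula (Fin n), φ.IsQF → (φ.Realize a ↔ φ.Realize b)

/-- A map is quantifier-free-type-preserving if tuples with the same complete
quantifier-free type are sent to tuples with the same complete quantifier-free type. -/
def QfTpPreserving (LA : Language) (A : Type*) [LA.Structure A]
    (LB : Language) (B : Type*) [LB.Structure B] (h : A → B) : Prop :=
  ∀ (n : ℕ) (a b : Fin n → A), SameQfTp LA A a b → SameQfTp LB B (h ∘ a) (h ∘ b)

/-- `g : A → B` and `f : B → A` witness that `A` is a semi-retraction of `B`. -/
def SemiRetractionWitness (LA : Language) (A : Type*) [LA.Structure A]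
    (LB : Language) (B : Type*) [LB.Structure B] (g : A → B) (f : B → A) : Prop :=
  Function.Injective g ∧ Function.Injective f ∧
    QfTpPreserving LA A LB B g ∧ QfTpPreserving LB B LA A f ∧
    ∀ (n : ℕ) (φ : LA.Formula (Fin n)), φ.IsQF →
      ∀ s : Fin n → A, φ.Realize s → φ.Realize (f ∘ g ∘ s)

/-- `A` is a semi-retraction of `B`. -/
def IsSemiRetractionOf (LA : Language) (A : Type*) [LA.Structure A]
    (LB : Language) (B : Type*) [LB.Structure B] : Prop :=
  ∃ (g : A → B) (f : B → A), SemiRetractionWitness LA A LB B g f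

/-- The Ramsey property for a class of structures `K`: for all `A B ∈ K` and `k ≥ 1` there is
`C ∈ K` such that every `k`-coloring of substructures of `C` admits a copy `B'` of `B` in `C`
on which the color of copies of `A` is constant. -/
def RamseyClass (L : Language) (K : Set (Bundled L.Structure)) : Prop :=
  ∀ A B : Bundled L.Structure, A ∈ K → B ∈ K → ∀ k : ℕ, 1 ≤ k →
    ∃ C : Bundled L.Structure, C ∈ K ∧
      ∀ c : L.Substructure C → Fin k,
        ∃ B' : L.Substructure C, Nonempty (B ≃[L] B') ∧
          ∀ A₁ A₂ : L.Substructure C, A₁ ≤ B' → A₂ ≤ B' →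
            Nonempty (A ≃[L] A₁) → Nonempty (A ≃[L] A₂) → c A₁ = c A₂

/-- A countable structure has the Ramsey property if its age does. -/
def HasRP (L : Language) (M : Type*) [L.Structure M] : Prop :=
  RamseyClass L (L.age M)

/-- `(a i : i ∈ I)` is an `I`-indexed indiscernible set of `d`-tuples in `U`. -/
def IndexedIndiscernible (L' : Language) (I : Type*) [L'.Structure I]
    (L : Language) (U : Type*) [L.Structure U] (d : ℕ) (a : I → Fin d → U) : Prop :=
  ∀ (n : ℕ) (ι κ : Fin n → I), SameQfTp L' I ι κ →
    ∀ φ : L.Formula (Fin n × Fin d),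
      (φ.Realize fun p => a (ι p.1) p.2) ↔ (φ.Realize fun p => a (κ p.1) p.2)

/-- `Y` realizes the EM-type of `X`: any formula satisfied by all `X`-tuples whose index tuple
has a given complete quantifier-free type in `I` is satisfied by the corresponding `Y`-tuple. -/
def LocallyBased (L' : Language) (I : Type*) [L'.Structure I]
    (L : Language) (U : Type*) [L.Structure U] (d : ℕ) (X Y : I → Fin d → U) : Prop :=
  ∀ (n : ℕ) (φ : L.Formula (Fin n × Fin d)) (ι : Fin n → I),
    (∀ κ : Fin n → I, SameQfTp L' I ι κ → φ.Realize fun p => X (κ p.1) p.2) →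
    (φ.Realize fun p => Y (ι p.1) p.2)

/-- `U` realizes every finitely-satisfiable set of formulas in one free variable with
countably many parameters: "sufficient saturation" for countable index structures. -/
def AlephOneSaturated (L : Language) (U : Type*) [L.Structure U] : Prop :=
  ∀ (p : ℕ → U) (Φ : Set (L.Formula (ℕ ⊕ Fin 1))),
    (∀ Φ₀ : Finset (L.Formula (ℕ ⊕ Fin 1)), ↑Φ₀ ⊆ Φ →
      ∃ x : U, ∀ φ ∈ Φ₀, Formula.Realize φ (Sum.elim p fun _ => x)) →
    ∃ x : U, ∀ φ ∈ Φ, Formula.Realize φ (Sum.elim p fun _ => x)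

/-- `I`-indexed indiscernible sets have the modeling property: in any sufficiently saturated
structure `U`, any `I`-indexed set of same-length tuples admits an `I`-indexed indiscernible
set in `U` locally based on it. -/
def ModelingProperty (L' : Language) (I : Type*) [L'.Structure I] : Prop :=
  ∀ (L : FirstOrder.Language.{0, 0}) (U : Type) [L.Structure U], AlephOneSaturated L U →
    ∀ (d : ℕ) (X : I → Fin d → U),
      ∃ Y : I → Fin d → U,
        IndexedIndiscernible L' I L U d Y ∧ LocallyBased L' I L U d X Y

end SRPaper

namespace SRPaper

/-! ### Disjoint unions and semi-direct product structures

An "ordered `L`-structure" is modelled as a type with an `L.Structure` instance (for the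
relations other than `<`) together with a `LinearOrder` instance (interpreting `<`); its full
language is `L.sum Language.order`. -/

attribute [local instance] FirstOrder.Language.orderStructure

/-- Relation symbols `E`: a single binary symbol. -/
inductive EqSymb : ℕ → Type
  | E : EqSymb 2

/-- The language `{E}` with one binary relation. -/
def langE : Language := ⟨fun _ => Empty, EqSymb⟩

/-- Unary predicate symbols `P i` for `i : O`. -/
inductive PredSymb (O : Type) : ℕ → Type
  | P (i : O) : PredSymb O 1

/-- The language `{P_i : i ∈ O}` of unary predicates. -/
def langP (O : Type) : Language := ⟨fun _ => Empty, PredSymb O⟩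

/-- A single binary relation symbol (for graphs). -/
inductive GrSymb : ℕ → Type
  | adj : GrSymb 2

/-- The language of graphs: one binary relation. -/
def langGr : Language := ⟨fun _ => Empty, GrSymb⟩

instance : langGr.IsRelational := fun _ => inferInstanceAs (IsEmpty Empty)

section Constructions

variable (O : Type) [LinearOrder O]

/-- Interpretation of a relational language `L1` on the disjoint union `Σₗ i, M i`,
where each relation is computed fiberwise (and fails on tuples meeting several fibers). -/
def fiberStructure (L1 : Language) [L1.IsRelational] (M : O → Type)
    [∀ i, L1.Structure (M i)] : L1.Structure (Σₗ i, M i) where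
  funMap := fun f _ => isEmptyElim f
  RelMap := fun {n} r v =>
    ∃ (i : O) (w : Fin n → M i), (∀ k, v k = toLex ⟨i, w k⟩) ∧ Structure.RelMap r w

/-- Interpretation of a relational language `L2` on the disjoint union `Σₗ i, M i` via the
projection to the index structure `O`. -/
def projStructure (L2 : Language) [L2.IsRelational] [L2.Structure O] (M : O → Type) :
    L2.Structure (Σₗ i, M i) where
  funMap := fun f _ => isEmptyElim f
  RelMap := fun {n} r v => Structure.RelMap r fun k => (ofLex (v k)).1

/-- Interpretation of `E` on `Σₗ i, M i`: the equivalence relation whose classes are the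
fibers `M i`. -/
def eqClassStructure (M : O → Type) : langE.Structure (Σₗ i, M i) where
  funMap := fun f _ => Empty.elim f
  RelMap := fun {n} r v =>
    match n, r, v with
    | _, EqSymb.E, v => (ofLex (v 0)).1 = (ofLex (v 1)).1

/-- Interpretation of the predicates `P i` on `Σₗ i, M i`: `P i` names the fiber `M i`. -/
def predStructure (M : O → Type) : (langP O).Structure (Σₗ i, M i) where
  funMap := fun f _ => Empty.elim f
  RelMap := fun {n} r v =>
    match n, r, v with
    | _, PredSymb.P i, v => (ofLex (v 0)).1 = i

/-- The language of `U_{i ∈ O}(M_i)`: the (common) language of the `M_i`, the order `<`,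
and the unary predicates `P_i`. -/
def langU (L1 : Language) (O : Type) : Language := (L1.sum Language.order).sum (langP O)

/-- The structure `U_{i ∈ O}(M_i)` on the disjoint union `Σₗ i, M i`: relations of `L1` are
computed fiberwise, `<` is the lexicographic order (fibers are convex, ordered by `O`), and
`P i` names the fiber `M i`. -/
instance uStructure (L1 : Language) [L1.IsRelational] (M : O → Type)
    [∀ i, L1.Structure (M i)] [∀ i, LinearOrder (M i)] :
    (langU L1 O).Structure (Σₗ i, M i) :=
  letI := fiberStructure O L1 M
  letI := predStructure O M
  inferInstanceAs (((L1.sum Language.order).sum (langP O)).Structure (Σₗ i, M i))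

/-- The language `L1 ∪ {<} ∪ {E}` (the reduct language of a semi-direct product, and the
language of `O(M_i | i ∈ I)` when the index structure is a pure linear order). -/
def langRed (L1 : Language) : Language := (L1.sum Language.order).sum langE

/-- The `L1 ∪ {<} ∪ {E}`-structure on `Σₗ i, M i`: relations of `L1` fiberwise, `<` the
lexicographic order, `E` the equivalence relation whose classes are the fibers.  For a pure
linear order index this is the structure `O(M_i | i ∈ O)`. -/
instance redStructure (L1 : Language) [L1.IsRelational] (M : O → Type)
    [∀ i, L1.Structure (M i)] [∀ i, LinearOrder (M i)] :
    (langRed L1).Structure (Σₗ i, M i) :=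
  letI := fiberStructure O L1 M
  letI := eqClassStructure O M
  inferInstanceAs (((L1.sum Language.order).sum langE).Structure (Σₗ i, M i))

/-- The language `L2 ∪ L1 ∪ {E}` (with the shared order `<`) of a semi-direct product
structure. -/
def langSD (L1 L2 : Language) : Language := (langRed L1).sum L2

/-- The semi-direct product structure `𝕀 = I-script_{i ∈ I}(M_i)` on `Σₗ i, M i`:
relations of `L1` fiberwise, `<` the lexicographic order, `E` the fiber equivalence
relation, and relations of `L2` computed from the index structure via the projection. -/
instance sdStructure (L2 : Language) [L2.IsRelational] [L2.Structure O]
    (L1 : Language) [L1.IsRelational] (M : O → Type)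
    [∀ i, L1.Structure (M i)] [∀ i, LinearOrder (M i)] :
    (langSD L1 L2).Structure (Σₗ i, M i) :=
  letI := projStructure O L2 M
  inferInstanceAs (((langRed L1).sum L2).Structure (Σₗ i, M i))

end Constructions

/-- The underlying set of the "underlying graph" `gr(ā)` of a tuple from a semi-direct
product structure: the set of indices whose fiber meets the tuple. -/
def grSet {O : Type} {M : O → Type} {n : ℕ} (a : Fin n → (Σₗ i, M i)) : Set O :=
  {t | ∃ k, (ofLex (a k)).1 = t}

/-- The full language of ordered graphs: one binary relation and the order. -/
def langOG : Language := langGr.sum Language.order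

/-- A finite or countable `langOG`-structure is an ordered graph when the binary relation is
irreflexive and symmetric and the order symbol is interpreted as a linear order. -/
def IsOrderedGraph (N : Type*) [langOG.Structure N] : Prop :=
  (∀ x : N, ¬ Structure.RelMap (L := langOG) (Sum.inl GrSymb.adj) ![x, x]) ∧
  (∀ x y : N, Structure.RelMap (L := langOG) (Sum.inl GrSymb.adj) ![x, y] →
    Structure.RelMap (L := langOG) (Sum.inl GrSymb.adj) ![y, x]) ∧
  IsLinearOrder N (fun a b =>
    Structure.RelMap (L := langOG) (Sum.inr Language.orderRel.le) ![a, b])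

/-- A random ordered graph: a countable structure that is a Fraïssé limit of the class of
finite ordered graphs. -/
def IsRandomOrderedGraph (G : Type) [langGr.Structure G] [LinearOrder G] [Countable G] : Prop :=
  letI : langOG.Structure G := inferInstanceAs ((langGr.sum Language.order).Structure G)
  haveI : ∀ l, IsEmpty (langOG.Functions l) := fun _ => inferInstanceAs (IsEmpty (Empty ⊕ Empty))
  IsFraisseLimit {N : CategoryTheory.Bundled langOG.Structure | Finite N ∧ IsOrderedGraph N} G

end SRPaper

attribute [local instance] FirstOrder.Language.orderStructure

namespace SRPaper

/-- The language `{E, <}`. -/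
def langEO : Language := langE.sum Language.order

/-- The `{E, <}`-reduct structure on the semi-direct product domain `Σₗ i, M i`. -/
instance eoStructure (O : Type) [LinearOrder O] (M : O → Type) [∀ i, LinearOrder (M i)] :
    langEO.Structure (Σₗ i, M i) :=
  letI := eqClassStructure O M
  letI := FirstOrder.Language.orderStructure (M := (Σₗ i, M i))
  inferInstanceAs ((langE.sum Language.order).Structure (Σₗ i, M i))

universe u v

/-- A complete theory `T` has the independence property if some formula `φ(x̄, ȳ)` shatters
an infinite set of tuples in some model of `T`. -/
def HasIP (L : FirstOrder.Language.{u, v}) (T : L.Theory) : Prop :=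
  ∃ (nx ny : ℕ) (φ : L.Formula (Fin nx ⊕ Fin ny)) (N : Theory.ModelType.{u, v, max u v} T)
    (aa : ℕ → Fin nx → N) (bb : Set ℕ → Fin ny → N),
    ∀ (i : ℕ) (S : Set ℕ), (φ.Realize (Sum.elim (aa i) (bb S)) ↔ i ∈ S)

end SRPaper

namespace SRPaper

/-- finite Ramsey for increasing tuples -/
theorem ramsey_pre (a : ℕ) (κ : Type) [Finite κ]
    (ih : ∀ b : ℕ, ∃ p : ℕ, ∀ (c : Finset ℕ → κ) (X : Finset ℕ), p ≤ X.card →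
      ∃ S ⊆ X, S.card = b ∧ ∃ k, ∀ J ⊆ S, J.card = a → c J = k) (t : ℕ) :
    ∃ p : ℕ, ∀ (c : Finset ℕ → κ) (X : Finset ℕ), p ≤ X.card →
      ∃ S ⊆ X, S.card = t ∧ ∃ g : ℕ → κ, ∀ x ∈ S, ∀ J ⊆ S, J.card = a → (∀ y ∈ J, x < y) →
        c (insert x J) = g x := by
  classical
  induction t with
  | zero =>
    refine ⟨1, fun c X hX => ⟨∅, by simp, rfl, fun x => c ∅, by simp⟩⟩
  | succ t iht =>
    obtain ⟨p, hp⟩ := iht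
    obtain ⟨q, hq⟩ := ih p
    refine ⟨q + 1, fun c X hX => ?_⟩
    have hne : X.Nonempty := by
      rw [← Finset.card_pos]; omega
    set x := X.min' hne with hx
    have hxX : x ∈ X := X.min'_mem hne
    obtain ⟨S, hS, hSc, k, hk⟩ := hq (fun J => c (insert x J)) (X.erase x)
      (by rw [Finset.card_erase_of_mem hxX]; omega)
    obtain ⟨S', hS', hSc', g, hg⟩ := hp c S hSc.ge
    have hlt : ∀ y ∈ S', x < y := fun y hy => by
      have h1 := hS (hS' hy)
      rw [Finset.mem_erase] at h1
      exact lt_of_le_of_ne (X.min'_le y h1.2) (Ne.symm h1.1)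
    have hxS : x ∉ S' := fun h => lt_irrefl _ (hlt x h)
    refine ⟨insert x S', ?_, ?_, fun y => if y = x then k else g y, ?_⟩
    · intro y hy
      rcases Finset.mem_insert.1 hy with rfl | hy
      · exact hxX
      · exact Finset.mem_of_mem_erase (hS (hS' hy))
    · rw [Finset.card_insert_of_notMem hxS, hSc']
    · intro y hy J hJ hJc hyJ
      have hJS : J ⊆ S' := by
        intro z hz
        rcases Finset.mem_insert.1 (hJ hz) with h | h
        · subst h
          have := hyJ _ hz
          rcases Finset.mem_insert.1 hy with h | h
          · omega
          · have := hlt _ h; omega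
        · exact h
      rcases Finset.mem_insert.1 hy with h | h
      · subst h
        simpa using hk J (hJS.trans hS') hJc
      · have : y ≠ x := fun e => hxS (e ▸ h)
        simpa [this] using hg y h J hJS hJc hyJ

theorem ramsey_one (κ : Type) [Finite κ] (a : ℕ) : ∀ b : ℕ, ∃ p : ℕ, ∀ (c : Finset ℕ → κ)
    (X : Finset ℕ), p ≤ X.card →
      ∃ S ⊆ X, S.card = b ∧ ∃ k, ∀ J ⊆ S, J.card = a → c J = k := by
  classical
  induction a with
  | zero =>
    intro b
    refine ⟨b, fun c X hX => ?_⟩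
    obtain ⟨S, hS, hc⟩ := Finset.exists_subset_card_eq hX
    refine ⟨S, hS, hc, c ∅, fun J _ hJ => ?_⟩
    rw [Finset.card_eq_zero.1 hJ]
  | succ a ih =>
    intro b
    have := Fintype.ofFinite κ
    obtain ⟨p, hp⟩ := ramsey_pre a κ ih (Fintype.card κ * b + 1)
    refine ⟨p, fun c X hX => ?_⟩
    obtain ⟨S, hS, hSc, g, hg⟩ := hp c X hX
    obtain ⟨k, -, hk⟩ := Finset.exists_lt_card_fiber_of_mul_lt_card_of_maps_to
      (s := S) (t := Finset.univ) (f := g) (n := b) (by simp) (by rw [hSc]; simp)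
    obtain ⟨S', hS', hc'⟩ := Finset.exists_subset_card_eq hk.le
    refine ⟨S', (hS'.trans (Finset.filter_subset _ _)).trans hS, hc', k, fun J hJ hJc => ?_⟩
    have hne : J.Nonempty := by rw [← Finset.card_pos]; omega
    have hm := J.min'_mem hne
    rw [← Finset.insert_erase hm, hg (J.min' hne)]
    · exact (Finset.mem_filter.1 (hS' (hJ hm))).2
    · exact (Finset.mem_filter.1 (hS' (hJ hm))).1
    · exact (Finset.erase_subset _ _).trans (hJ.trans (hS'.trans (Finset.filter_subset _ _)))
    · rw [Finset.card_erase_of_mem hm]; omega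
    · intro y hy
      exact J.min'_lt_of_mem_erase_min' hne hy

/-- Ramsey for all sizes `a < n` simultaneously, for increasing tuples. -/
theorem ramsey_emb (κ : ℕ → Type) [∀ a, Finite (κ a)] (n : ℕ) : ∀ b : ℕ, ∃ p : ℕ,
    ∀ c : ∀ a, (Fin a ↪o Fin p) → κ a, ∃ S : Fin b ↪o Fin p,
      ∀ a < n, ∀ j j' : Fin a ↪o Fin b, c a (j.trans S) = c a (j'.trans S) := by
  classical
  induction n with
  | zero => exact fun b => ⟨b, fun c => ⟨RelEmbedding.refl _, by simp⟩⟩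
  | succ n ih =>
    intro b
    obtain ⟨q, hq⟩ := ih b
    obtain ⟨p, hp⟩ := ramsey_one (Option (κ n)) n q
    refine ⟨p, fun c => ?_⟩
    obtain ⟨S, hS, hSc, k, hk⟩ := hp (fun J => if h : J.card = n ∧ ∀ x ∈ J, x < p then
        some (c n (OrderEmbedding.ofStrictMono
          (fun i => (⟨J.orderEmbOfFin h.1 i, h.2 _ (J.orderEmbOfFin_mem h.1 i)⟩ : Fin p))
          (fun i i' hi => (J.orderEmbOfFin h.1).strictMono hi))) else none)
      (Finset.range p) (by simp)
    have hSp : ∀ i, S.orderEmbOfFin hSc i < p := fun i =>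
      Finset.mem_range.1 (hS (S.orderEmbOfFin_mem hSc i))
    let E : Fin q ↪o Fin p := OrderEmbedding.ofStrictMono (fun i => ⟨S.orderEmbOfFin hSc i, hSp i⟩)
      (fun i i' hi => (S.orderEmbOfFin hSc).strictMono hi)
    have key : ∀ j : Fin n ↪o Fin q, some (c n (j.trans E)) = k := by
      intro j
      let f : Fin n ↪o ℕ := j.trans (S.orderEmbOfFin hSc)
      have hfS : ∀ i, f i ∈ S := fun i => S.orderEmbOfFin_mem hSc _
      have hc : (Finset.univ.map f.toEmbedding).card = n := by simp
      have h1 := hk (Finset.univ.map f.toEmbedding) (by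
        intro x hx
        obtain ⟨i, -, rfl⟩ := Finset.mem_map.1 hx
        exact hfS i) hc
      have hlt : ∀ x ∈ Finset.univ.map f.toEmbedding, x < p := by
        intro x hx
        obtain ⟨i, -, rfl⟩ := Finset.mem_map.1 hx
        exact hSp _
      rw [dif_pos ⟨hc, hlt⟩] at h1
      rw [← h1]
      congr 2
      ext i
      have : f = (Finset.univ.map f.toEmbedding).orderEmbOfFin hc :=
        Finset.orderEmbOfFin_unique' hc (fun x => by simp)
      exact congrArg (fun g : Fin n ↪o ℕ => g i) this
    obtain ⟨S', hS'⟩ := hq (fun a j => c a (j.trans E))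
    refine ⟨S'.trans E, fun a ha => ?_⟩
    rcases Nat.lt_succ_iff_lt_or_eq.1 ha with h | rfl
    · exact hS' a h
    · intro j j'
      exact Option.some_injective _ ((key (j.trans S')).trans (key (j'.trans S')).symm)

end SRPaper

namespace SRPaper

/-- A finite `p`-partite (directed) graph. -/
structure PG (p : ℕ) where
  V : Type
  fin : Finite V
  part : V → Fin p
  adj : V → V → Prop

/-- Part-preserving embeddings of partite graphs. -/
def PG.Mor {p : ℕ} (P Q : PG p) (e : P.V → Q.V) : Prop :=
  (∀ v, Q.part (e v) = P.part v) ∧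
    ∀ u v, P.part u < P.part v → (Q.adj (e u) (e v) ↔ P.adj u v)

/-- Transversal copies of the graph `A` over the parts `j`. -/
def PG.Copy {p : ℕ} (P : PG p) {a : ℕ} (j : Fin a ↪o Fin p) (A : Fin a → Fin a → Prop)
    (x : Fin a → P.V) : Prop :=
  (∀ s, P.part (x s) = j s) ∧ ∀ s t, s < t → (P.adj (x s) (x t) ↔ A s t)

theorem PG.Mor.copy {p : ℕ} {P Q : PG p} {e : P.V → Q.V} (h : P.Mor Q e) {a : ℕ}
    {j : Fin a ↪o Fin p} {A : Fin a → Fin a → Prop} {x : Fin a → P.V} (hx : P.Copy j A x) :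
    Q.Copy j A (e ∘ x) := by
  refine ⟨fun s => (h.1 _).trans (hx.1 s), fun s t hst => ?_⟩
  refine (h.2 _ _ ?_).trans (hx.2 s t hst)
  rw [hx.1, hx.1]
  exact j.strictMono hst

theorem PG.Mor.comp {p : ℕ} {P Q R : PG p} {e : P.V → Q.V} {f : Q.V → R.V} (h : P.Mor Q e)
    (h' : Q.Mor R f) : P.Mor R (f ∘ e) :=
  ⟨fun v => (h'.1 _).trans (h.1 v), fun u v huv =>
    (h'.2 _ _ (by rw [h.1, h.1]; exact huv)).trans (h.2 u v huv)⟩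

open Combinatorics in
/-- The map associated to a line in the partite lemma. -/
noncomputable def lineMap {p : ℕ} (P : PG p) {a : ℕ} (j : Fin a ↪o Fin p)
    (A : Fin a → Fin a → Prop) {ι : Type} (l : Line {x : Fin a → P.V // P.Copy j A x} ι)
    (v : P.V) : (Fin a × (ι → P.V)) ⊕ (Line {x : Fin a → P.V // P.Copy j A x} ι × P.V) :=
  open Classical in
  if h : ∃ s, j s = P.part v then
    Sum.inl (h.choose, fun t => ((l.idxFun t).map (fun x => x.1 h.choose)).getD v)
  else Sum.inr (l, v)

open Combinatorics in
theorem lineMap_pos {p : ℕ} (P : PG p) {a : ℕ} (j : Fin a ↪o Fin p)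
    (A : Fin a → Fin a → Prop) {ι : Type} (l : Line {x : Fin a → P.V // P.Copy j A x} ι)
    (v : P.V) (s : Fin a) (hs : j s = P.part v) : lineMap P j A l v =
    Sum.inl (s, fun t => ((l.idxFun t).map (fun x => x.1 s)).getD v) := by
  have h : ∃ s, j s = P.part v := ⟨s, hs⟩
  have h2 : h.choose = s := j.injective (h.choose_spec.trans hs.symm)
  unfold lineMap
  rw [dif_pos h, h2]

open Combinatorics in
theorem lineMap_neg {p : ℕ} (P : PG p) {a : ℕ} (j : Fin a ↪o Fin p)
    (A : Fin a → Fin a → Prop) {ι : Type} (l : Line {x : Fin a → P.V // P.Copy j A x} ι)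
    (v : P.V) (hs : ¬ ∃ s, j s = P.part v) : lineMap P j A l v = Sum.inr (l, v) := by
  unfold lineMap
  rw [dif_neg hs]

open Combinatorics in
theorem lineMap_inj {p : ℕ} (P : PG p) {a : ℕ} (j : Fin a ↪o Fin p)
    (A : Fin a → Fin a → Prop) {ι : Type} (l : Line {x : Fin a → P.V // P.Copy j A x} ι)
    (u v : P.V) (h : lineMap P j A l u = lineMap P j A l v) : u = v := by
  by_cases hu : ∃ s, j s = P.part u
  · obtain ⟨s, hs⟩ := hu
    by_cases hv : ∃ s, j s = P.part v
    · obtain ⟨t, ht⟩ := hv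
      rw [lineMap_pos P j A l u s hs, lineMap_pos P j A l v t ht] at h
      obtain ⟨i, hi⟩ := l.proper
      have := congrFun (Prod.ext_iff.1 (Sum.inl_injective h)).2 i
      simpa [hi] using this
    · rw [lineMap_pos P j A l u s hs, lineMap_neg P j A l v hv] at h
      cases h
  · by_cases hv : ∃ s, j s = P.part v
    · obtain ⟨t, ht⟩ := hv
      rw [lineMap_neg P j A l u hu, lineMap_pos P j A l v t ht] at h
      cases h
    · rw [lineMap_neg P j A l u hu, lineMap_neg P j A l v hv] at h
      exact (Prod.ext_iff.1 (Sum.inr_injective h)).2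

open Combinatorics in
theorem lineMap_eq_inr {p : ℕ} (P : PG p) {a : ℕ} (j : Fin a ↪o Fin p)
    (A : Fin a → Fin a → Prop) {ι : Type} (l l' : Line {x : Fin a → P.V // P.Copy j A x} ι)
    (u v : P.V) (h : lineMap P j A l u = Sum.inr (l', v)) : l = l' := by
  by_cases hu : ∃ s, j s = P.part u
  · obtain ⟨s, hs⟩ := hu
    rw [lineMap_pos P j A l u s hs] at h
    cases h
  · rw [lineMap_neg P j A l u hu] at h
    exact (Prod.ext_iff.1 (Sum.inr_injective h)).1

open Combinatorics in
/-- The graph of the partite lemma. -/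
noncomputable def powPG {p : ℕ} (P : PG p) {a : ℕ} (j : Fin a ↪o Fin p)
    (A : Fin a → Fin a → Prop) (ι : Type) [Finite ι] : PG p where
  V := (Fin a × (ι → P.V)) ⊕ (Line {x : Fin a → P.V // P.Copy j A x} ι × P.V)
  fin := by
    have := P.fin
    have : Finite (Line {x : Fin a → P.V // P.Copy j A x} ι) :=
      Finite.of_injective (fun l => l.idxFun) (fun l l' h => Line.ext h)
    infer_instance
  part := Sum.elim (fun q => j q.1) (fun q => P.part q.2)
  adj := fun y z => match y, z with
    | Sum.inl (s, f), Sum.inl (t, g) =>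
      (A s t ∧ ∀ i, P.adj (f i) (g i)) ∨ (¬ A s t ∧ ∃ i, P.adj (f i) (g i))
    | y, z => ∃ l u v, lineMap P j A l u = y ∧ lineMap P j A l v = z ∧ P.adj u v

open Combinatorics in
theorem lineMap_mor {p : ℕ} (P : PG p) {a : ℕ} (j : Fin a ↪o Fin p)
    (A : Fin a → Fin a → Prop) (ι : Type) [Finite ι]
    (l : Line {x : Fin a → P.V // P.Copy j A x} ι) :
    P.Mor (powPG P j A ι) (lineMap P j A l) := by
  have hpart : ∀ v, (powPG P j A ι).part (lineMap P j A l v) = P.part v := by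
    intro v
    by_cases hv : ∃ s, j s = P.part v
    · obtain ⟨s, hs⟩ := hv
      rw [lineMap_pos P j A l v s hs]
      exact hs
    · rw [lineMap_neg P j A l v hv]; rfl
  refine ⟨hpart, fun u v huv => ?_⟩
  by_cases hu : ∃ s, j s = P.part u
  · obtain ⟨s, hs⟩ := hu
    by_cases hv : ∃ s, j s = P.part v
    · obtain ⟨t, ht⟩ := hv
      rw [lineMap_pos P j A l u s hs, lineMap_pos P j A l v t ht]
      have hst : s < t := by rw [← hs, ← ht] at huv; exact j.lt_iff_lt.1 huv
      obtain ⟨i0, hi0⟩ := l.proper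
      change (A s t ∧ ∀ i, P.adj _ _) ∨ (¬ A s t ∧ ∃ i, P.adj _ _) ↔ _
      have hcase : ∀ i, (P.adj (((l.idxFun i).map (fun x => x.1 s)).getD u)
          (((l.idxFun i).map (fun x => x.1 t)).getD v)) ↔
          (l.idxFun i = none ∧ P.adj u v) ∨ (l.idxFun i ≠ none ∧ A s t) := by
        intro i
        cases h : l.idxFun i with
        | none => simp
        | some x => simpa using x.2.2 s t hst
      simp only [hcase]
      by_cases hA : A s t
      · simp only [hA, true_and, not_true, false_and, or_false, and_true]
        constructor
        · intro h
          rcases h i0 with h | h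
          · exact h.2
          · exact absurd hi0 h
        · intro h i
          by_cases hi : l.idxFun i = none
          · exact Or.inl ⟨hi, h⟩
          · exact Or.inr hi
      · simp only [hA, false_and, not_false_iff, true_and, false_or, and_false, or_false]
        exact ⟨fun ⟨i, h⟩ => h.2, fun h => ⟨i0, hi0, h⟩⟩
    · rw [lineMap_neg P j A l v hv]
      have hd : (powPG P j A ι).adj (lineMap P j A l u) (Sum.inr (l, v)) ↔
          ∃ l' u' v', lineMap P j A l' u' = lineMap P j A l u ∧
            lineMap P j A l' v' = Sum.inr (l, v) ∧ P.adj u' v' := by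
        rw [lineMap_pos P j A l u s hs]; rfl
      rw [hd]
      constructor
      · rintro ⟨l', u', v', h1, h2, h3⟩
        obtain rfl := lineMap_eq_inr P j A l' l _ _ h2
        rw [← lineMap_neg P j A l' v hv] at h2
        rwa [← lineMap_inj P j A _ _ _ h1, ← lineMap_inj P j A _ _ _ h2]
      · intro h
        exact ⟨l, u, v, rfl, lineMap_neg P j A l v hv, h⟩
  · have hd : (powPG P j A ι).adj (lineMap P j A l u) (lineMap P j A l v) ↔
          ∃ l' u' v', lineMap P j A l' u' = lineMap P j A l u ∧
            lineMap P j A l' v' = lineMap P j A l v ∧ P.adj u' v' := by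
        rw [lineMap_neg P j A l u hu]; rfl
    rw [hd]
    constructor
    · rintro ⟨l', u', v', h1, h2, h3⟩
      have := h1
      rw [lineMap_neg P j A l u hu] at this
      obtain rfl := lineMap_eq_inr P j A l' l _ _ this
      rwa [← lineMap_inj P j A _ _ _ h1, ← lineMap_inj P j A _ _ _ h2]
    · intro h
      exact ⟨l, u, v, rfl, rfl, h⟩

/-- Partite lemma. -/
theorem partite_lemma {p : ℕ} (κ : Type) [Finite κ] (P : PG p) {a : ℕ} (j : Fin a ↪o Fin p)
    (A : Fin a → Fin a → Prop) : ∃ Q : PG p, ∀ c : ∀ a, (Fin a → Q.V) → κ,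
      ∃ e, P.Mor Q e ∧ ∀ x x', P.Copy j A x → P.Copy j A x' → c a (e ∘ x) = c a (e ∘ x') := by
  have := P.fin
  obtain ⟨ι, hι, H⟩ := Combinatorics.Line.exists_mono_in_high_dimension
    {x : Fin a → P.V // P.Copy j A x} κ
  refine ⟨powPG P j A ι, fun c => ?_⟩
  obtain ⟨l, k, hk⟩ := H (fun y => c a (fun s => Sum.inl (s, fun t => (y t).1 s)))
  refine ⟨lineMap P j A l, lineMap_mor P j A ι l, ?_⟩
  have key : ∀ x, P.Copy j A x → c a (lineMap P j A l ∘ x) = k := by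
    intro x hx
    rw [← hk ⟨x, hx⟩]
    congr 1
    funext s
    refine (lineMap_pos P j A l (x s) s (hx.1 s).symm).trans ?_
    congr 2
    funext t
    rw [Combinatorics.Line.apply_def]
    cases h : l.idxFun t <;> simp [h]
  intro x x' hx hx'
  rw [key x hx, key x' hx']

theorem partite_list {p : ℕ} (κ : Type) [Finite κ]
    (l : List (Σ a : ℕ, (Fin a ↪o Fin p) × (Fin a → Fin a → Prop))) : ∀ (P : PG p),
    ∃ Q : PG p, ∀ c : ∀ a, (Fin a → Q.V) → κ, ∃ e, P.Mor Q e ∧ ∀ q ∈ l, ∀ x x',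
      P.Copy q.2.1 q.2.2 x → P.Copy q.2.1 q.2.2 x' → c q.1 (e ∘ x) = c q.1 (e ∘ x') := by
  induction l with
  | nil => exact fun P => ⟨P, fun c => ⟨id, ⟨fun _ => rfl, fun _ _ _ => Iff.rfl⟩, by simp⟩⟩
  | cons q l ih =>
    intro P
    obtain ⟨Q, hQ⟩ := ih P
    obtain ⟨Q', hQ'⟩ := partite_lemma κ Q q.2.1 q.2.2
    refine ⟨Q', fun c => ?_⟩
    obtain ⟨e', he', h'⟩ := hQ' c
    obtain ⟨e, he, h⟩ := hQ (fun a x => c a (e' ∘ x))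
    refine ⟨e' ∘ e, he.comp he', fun r hr x x' hx hx' => ?_⟩
    rcases List.mem_cons.1 hr with rfl | hr
    · exact h' _ _ (he.copy hx) (he.copy hx')
    · exact h r hr x x' hx hx'

/-- Ramsey theorem for finite ordered graphs (Nešetřil–Rödl, Abramson–Harrington). -/
theorem graph_ramsey (κ : Type) [Finite κ] (b : ℕ) (G : Fin b → Fin b → Prop) :
    ∃ (V : Type) (_ : Finite V) (adj : V → V → Prop), ∀ c : ∀ a, (Fin a → V) → κ,
      ∃ e : Fin b → V, (∀ s t, s < t → (adj (e s) (e t) ↔ G s t)) ∧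
        ∀ a (j j' : Fin a ↪o Fin b),
          (∀ s t, s < t → (G (j s) (j t) ↔ G (j' s) (j' t))) → c a (e ∘ j) = c a (e ∘ j') := by
  classical
  obtain ⟨p, hp⟩ := ramsey_emb (fun a => (Fin a → Fin a → Prop) → Option κ) (b + 1) b
  let P : PG p :=
    { V := (Fin b ↪o Fin p) × Fin b
      fin := by
        have : Finite (Fin b ↪o Fin p) := Finite.of_injective (fun f => (f : Fin b → Fin p))
          DFunLike.coe_injective
        infer_instance
      part := fun v => v.1 v.2
      adj := fun u v => u.1 = v.1 ∧ G u.2 v.2 }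
  have hfin : Finite (Σ a : Fin (b + 1), (Fin a ↪o Fin p) × (Fin a → Fin a → Prop)) := by
    have : ∀ a : ℕ, Finite (Fin a ↪o Fin p) := fun a =>
      Finite.of_injective (fun f => (f : Fin a → Fin p)) DFunLike.coe_injective
    infer_instance
  have := Fintype.ofFinite (Σ a : Fin (b + 1), (Fin a ↪o Fin p) × (Fin a → Fin a → Prop))
  let up : (Σ a : Fin (b + 1), (Fin a ↪o Fin p) × (Fin a → Fin a → Prop)) →
    (Σ a : ℕ, (Fin a ↪o Fin p) × (Fin a → Fin a → Prop)) := fun q => ⟨(q.1 : ℕ), q.2⟩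
  obtain ⟨Q, hQ⟩ := partite_list κ ((Finset.univ.toList :
    List (Σ a : Fin (b + 1), (Fin a ↪o Fin p) × (Fin a → Fin a → Prop))).map up) P
  refine ⟨Q.V, Q.fin, Q.adj, fun c => ?_⟩
  obtain ⟨e, he, h⟩ := hQ c
  have h' : ∀ a, a < b + 1 → ∀ (j : Fin a ↪o Fin p) (A : Fin a → Fin a → Prop) x x',
      P.Copy j A x → P.Copy j A x' → c a (e ∘ x) = c a (e ∘ x') := by
    intro a ha j A x x' hx hx'
    exact h ⟨a, j, A⟩ (List.mem_map.2 ⟨⟨⟨a, ha⟩, j, A⟩, by simp, rfl⟩) x x' hx hx'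
  obtain ⟨S, hS⟩ := hp (fun a j A => if hx : ∃ x, P.Copy j A x then some (c a (e ∘ hx.choose))
    else none)
  have hcopy : ∀ a (j : Fin a ↪o Fin b),
      P.Copy (j.trans S) (fun s t => G (j s) (j t)) (fun s => (S, j s)) := by
    intro a j
    refine ⟨fun s => rfl, fun s t _ => ?_⟩
    exact ⟨fun h => h.2, fun h => ⟨rfl, h⟩⟩
  refine ⟨fun s => e (S, s), fun s t hst => ?_, fun a j j' hjj => ?_⟩
  · refine (he.2 _ _ (S.strictMono hst)).trans ?_
    exact ⟨fun h => h.2, fun h => ⟨rfl, h⟩⟩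
  · have ha : a < b + 1 := Nat.lt_succ_of_le (by simpa using Fintype.card_le_of_embedding j.toEmbedding)
    have hc1 := hcopy a j
    have hc2 : P.Copy (j'.trans S) (fun s t => G (j s) (j t)) (fun s => (S, j' s)) := by
      refine ⟨fun s => rfl, fun s t hst => ?_⟩
      refine Iff.trans ?_ (hjj s t hst).symm
      exact ⟨fun h => h.2, fun h => ⟨rfl, h⟩⟩
    have e1 := congrFun (hS a ha j j') (fun s t => G (j s) (j t))
    have x1 : ∃ x, P.Copy (j.trans S) (fun s t => G (j s) (j t)) x := ⟨_, hc1⟩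
    have x2 : ∃ x, P.Copy (j'.trans S) (fun s t => G (j s) (j t)) x := ⟨_, hc2⟩
    rw [dif_pos x1, dif_pos x2] at e1
    have e2 := Option.some_injective _ e1
    exact (h' a ha _ _ _ _ hc1 x1.choose_spec).trans
      (e2.trans (h' a ha _ _ _ _ hc2 x2.choose_spec).symm)

end SRPaper

namespace SRPaper
universe u v

universe w w'

theorem compactness_formulas {L : FirstOrder.Language.{u, v}} (T : L.Theory) {α : Type w}
    (Γ : Set (L.Formula α))
    (h : ∀ Γ₀ : Finset (L.Formula α), ↑Γ₀ ⊆ Γ →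
      ∃ (N : Theory.ModelType.{u, v, w'} T) (x : α → N), ∀ φ ∈ Γ₀, φ.Realize x) :
    ∃ (N : Theory.ModelType.{u, v, max u v w} T) (x : α → N), ∀ φ ∈ Γ, φ.Realize x := by
  classical
  have hs : ((L.lhomWithConstants α).onTheory T ∪ Set.image Formula.equivSentence Γ).IsSatisfiable := by
    rw [Theory.isSatisfiable_iff_isFinitelySatisfiable]
    intro T₀ hT₀
    obtain ⟨N, x, hx⟩ := h ((T₀.image Formula.equivSentence.symm).filter (· ∈ Γ)) (by
      intro φ hφ
      simp only [Finset.coe_filter, Set.mem_setOf_eq] at hφ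
      exact hφ.2)
    letI : (constantsOn α).Structure N := constantsOn.structure x
    have hN : N ⊨ (L.lhomWithConstants α).onTheory T :=
      (LHom.onTheory_model _ _).2 inferInstance
    have : N ⊨ (T₀ : (L[[α]]).Theory) := by
      rw [Theory.model_iff]
      intro σ hσ
      rcases hT₀ hσ with h1 | ⟨φ, hφ, rfl⟩
      · exact hN.realize_of_mem σ h1
      · rw [Formula.realize_equivSentence]
        refine hx φ ?_
        simp only [Finset.mem_filter, Finset.mem_image]
        exact ⟨⟨_, hσ, by simp⟩, hφ⟩
    exact Theory.Model.isSatisfiable N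
  obtain ⟨M⟩ := hs
  letI := (L.lhomWithConstants α).reduct M
  have h1 : M ⊨ (L.lhomWithConstants α).onTheory T :=
    Theory.Model.mono M.is_model Set.subset_union_left
  have h2 : M ⊨ T := (LHom.onTheory_model _ _).1 h1
  refine ⟨Theory.ModelType.of T M, fun a => (L.con a : M), fun φ hφ => ?_⟩
  have := M.is_model.realize_of_mem (Formula.equivSentence φ) (Or.inr ⟨φ, hφ, rfl⟩)
  rwa [Formula.realize_equivSentence] at this

/-- Formal names for elements of a saturated model. -/
inductive Tm (L : FirstOrder.Language.{u, v}) (B : Type w) : Type (max u v w)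
  | base : Option B → Tm L B
  | node : Set (L.Formula (ℕ ⊕ Fin 1)) → (ℕ → Tm L B) → Tm L B

/-- Direct subterm. -/
def Tm.Sub {L : FirstOrder.Language.{u, v}} {B : Type w} (x : Tm L B) : Tm L B → Prop
  | .base _ => False
  | .node _ p => ∃ k, x = p k

theorem Tm.wf {L : FirstOrder.Language.{u, v}} {B : Type w} :
    WellFounded (Tm.Sub : Tm L B → Tm L B → Prop) := by
  refine ⟨fun x => ?_⟩
  induction x with
  | base b => exact ⟨_, fun y hy => hy.elim⟩
  | node Φ p ih =>
    refine ⟨_, fun y hy => ?_⟩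
    obtain ⟨k, rfl⟩ := hy
    exact ih k

/-- The axioms saying that `node Φ p` realizes `Φ` over `p`. -/
def Tm.ax {L : FirstOrder.Language.{u, v}} {B : Type w} : Tm L B → Set (L.Formula (Tm L B))
  | .base _ => ∅
  | .node Φ p => Set.image (fun φ : L.Formula (ℕ ⊕ Fin 1) =>
      φ.relabel (Sum.elim p fun _ => Tm.node Φ p)) Φ

theorem exists_tm_model {L : FirstOrder.Language.{u, v}} (T : L.Theory) {B : Type w}
    (Γ : Set (L.Formula B))
    (hΓ : ∃ (N : Theory.ModelType.{u, v, w'} T) (x : B → N), ∀ φ ∈ Γ, φ.Realize x) :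
    ∃ (N : Theory.ModelType.{u, v, max u v w} T) (x : Tm L B → N),
      (∀ φ ∈ Γ, φ.Realize fun b => x (.base (some b))) ∧
      ∀ (p : ℕ → Tm L B) (Φ : Set (L.Formula (ℕ ⊕ Fin 1))),
        (∀ Φ₀ : Finset (L.Formula (ℕ ⊕ Fin 1)), ↑Φ₀ ⊆ Φ →
          ∃ y : N, ∀ φ ∈ Φ₀, Formula.Realize φ (Sum.elim (x ∘ p) fun _ => y)) →
        ∀ φ ∈ Φ, Formula.Realize φ (Sum.elim (x ∘ p) fun _ => x (.node Φ p)) := by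
  classical
  haveI : IsWellFounded (Tm L B) Tm.Sub := ⟨Tm.wf⟩
  obtain ⟨s, hs, hwo⟩ := IsWellFounded.exists_well_order_ge (Tm.Sub : Tm L B → Tm L B → Prop)
  have hswf : WellFounded s := hwo.wf
  letI : LinearOrder (Tm L B) := linearOrderOfSTO s
  let E0 : Set (L.Formula (Tm L B)) :=
    Set.image (fun φ : L.Formula B => φ.relabel fun b => Tm.base (some b)) Γ
  let Con : Set (L.Formula (Tm L B)) → Prop := fun Δ =>
    ∃ (N : Theory.ModelType.{u, v, max u v w} T) (x : Tm L B → N), ∀ φ ∈ Δ, φ.Realize x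
  have conE0 : Con E0 := by
    refine compactness_formulas.{u, v, max u v w, w'} T E0 fun Γ₀ hΓ₀ => ?_
    obtain ⟨N, x, hx⟩ := hΓ
    have hne : Nonempty N := inferInstance
    refine ⟨N, fun t => match t with
      | .base (some b) => x b
      | _ => hne.some, fun φ hφ => ?_⟩
    obtain ⟨ψ, hψ, rfl⟩ := hΓ₀ hφ
    rw [Formula.realize_relabel]
    exact hx ψ hψ
  let G : Tm L B → Prop := hswf.fix (fun g ih =>
    Con (E0 ∪ {φ | ∃ h, ∃ hh : s h g, ih h hh ∧ φ ∈ h.ax} ∪ g.ax))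
  have hG : ∀ g, G g = Con (E0 ∪ {φ | ∃ h, ∃ _ : s h g, G h ∧ φ ∈ h.ax} ∪ g.ax) := fun g =>
    hswf.fix_eq _ g
  have conAll : Con (E0 ∪ {φ | ∃ h, G h ∧ φ ∈ h.ax}) := by
    refine compactness_formulas.{u, v, max u v w, max u v w} T _ fun Γ₀ hΓ₀ => ?_
    have hch : ∀ φ : L.Formula (Tm L B), ∃ h : Tm L B, φ ∈ Γ₀ → φ ∉ E0 → G h ∧ φ ∈ h.ax := by
      intro φ
      by_cases hφ : φ ∈ Γ₀ ∧ φ ∉ E0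
      · rcases hΓ₀ hφ.1 with h | ⟨h, hh⟩
        · exact absurd h hφ.2
        · exact ⟨h, fun _ _ => hh⟩
      · exact ⟨.base none, fun h1 h2 => absurd ⟨h1, h2⟩ hφ⟩
    choose f hf using hch
    rcases ((Γ₀.filter (· ∉ E0)).image f).eq_empty_or_nonempty with he | hne
    · obtain ⟨N, x, hx⟩ := conE0
      refine ⟨N, x, fun φ hφ => hx φ ?_⟩
      by_contra hc
      have : f φ ∈ (Γ₀.filter (· ∉ E0)).image f :=
        Finset.mem_image_of_mem _ (Finset.mem_filter.2 ⟨hφ, hc⟩)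
      rw [he] at this
      simp at this
    · set g := ((Γ₀.filter (· ∉ E0)).image f).max' hne with hg
      have hgm := Finset.max'_mem _ hne
      rw [← hg] at hgm
      obtain ⟨φ₁, hφ₁, hφ₁g⟩ := Finset.mem_image.1 hgm
      rw [Finset.mem_filter] at hφ₁
      have hGg : G g := hφ₁g ▸ (hf φ₁ hφ₁.1 hφ₁.2).1
      rw [hG] at hGg
      obtain ⟨N, x, hx⟩ := hGg
      refine ⟨N, x, fun φ hφ => hx φ ?_⟩
      by_cases hc : φ ∈ E0
      · exact Or.inl (Or.inl hc)
      · have hle : f φ ≤ g := Finset.le_max' _ _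
          (Finset.mem_image_of_mem _ (Finset.mem_filter.2 ⟨hφ, hc⟩))
        have h3 := hf φ hφ hc
        rcases lt_or_eq_of_le hle with hlt | heq
        · exact Or.inl (Or.inr ⟨f φ, hlt, h3⟩)
        · exact Or.inr (heq ▸ h3.2)
  obtain ⟨N, x, hx⟩ := conAll
  refine ⟨N, x, fun φ hφ => ?_, fun p Φ hfin => ?_⟩
  · have := hx (φ.relabel fun b => Tm.base (some b)) (Or.inl ⟨φ, hφ, rfl⟩)
    rwa [Formula.realize_relabel] at this
  · have hGn : G (.node Φ p) := by
      rw [hG]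
      refine compactness_formulas.{u, v, max u v w, max u v w} T _ fun Γ₀ hΓ₀ => ?_
      obtain ⟨Φ₀, hΦ₀, himg⟩ : ∃ Φ₀ : Finset (L.Formula (ℕ ⊕ Fin 1)), ↑Φ₀ ⊆ Φ ∧
          Φ₀.image (fun φ : L.Formula (ℕ ⊕ Fin 1) =>
            φ.relabel (Sum.elim p fun _ => Tm.node Φ p)) =
            Γ₀.filter (· ∈ (Tm.node Φ p).ax) := by
        apply Finset.subset_set_image_iff.1
        intro φ hφ
        exact (Finset.mem_filter.1 (Finset.mem_coe.1 hφ)).2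
      obtain ⟨y, hy⟩ := hfin Φ₀ hΦ₀
      refine ⟨N, Function.update x (.node Φ p) y, fun φ hφ => ?_⟩
      by_cases hc : φ ∈ (Tm.node Φ p).ax
      · have : φ ∈ Γ₀.filter (· ∈ (Tm.node Φ p).ax) := Finset.mem_filter.2 ⟨hφ, hc⟩
        rw [← himg, Finset.mem_image] at this
        obtain ⟨ψ, hψ, rfl⟩ := this
        rw [Formula.realize_relabel]
        convert hy ψ hψ using 1
        funext k
        rcases k with k | k
        · have hlt : s (p k) (.node Φ p) := hs _ _ ⟨k, rfl⟩
          have hne : p k ≠ .node Φ p := ne_of_lt hlt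
          simp [hne]
        · simp
      · rcases hΓ₀ hφ with (h | ⟨h, hh, hGh, hφh⟩) | h
        · obtain ⟨ψ, hψ, rfl⟩ := h
          have := hx _ (Or.inl ⟨ψ, hψ, rfl⟩)
          simp only [Formula.realize_relabel] at this ⊢
          convert this using 1
          funext b
          simp
        · have h1 := hx φ (Or.inr ⟨h, hGh, hφh⟩)
          have hne : h ≠ .node Φ p := ne_of_lt hh
          cases h with
          | base b => exact hφh.elim
          | node Φ' p' =>
            obtain ⟨ψ, hψ, rfl⟩ := hφh
            simp only [Formula.realize_relabel] at h1 ⊢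
            convert h1 using 1
            funext k
            rcases k with k | k
            · have hlt : s (p' k) (.node Φ' p') := hs _ _ ⟨k, rfl⟩
              have hne : p' k ≠ .node Φ p := ne_of_lt (lt_trans (show p' k < _ from hlt) hh)
              simp [hne]
            · simp only [Function.comp_apply, Sum.elim_inr]
              rw [Function.update_of_ne hne]
        · exact absurd h hc
    intro φ hφ
    have := hx (φ.relabel (Sum.elim p fun _ => Tm.node Φ p)) (Or.inr ⟨_, hGn, ⟨φ, hφ, rfl⟩⟩)
    rw [Formula.realize_relabel] at this
    convert this using 1
    funext k
    rcases k with k | k <;> rfl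

theorem exists_saturated {L : FirstOrder.Language.{u, v}} (T : L.Theory) {B : Type w}
    (Γ : Set (L.Formula B))
    (hΓ : ∃ (N : Theory.ModelType.{u, v, w'} T) (x : B → N), ∀ φ ∈ Γ, φ.Realize x) :
    ∃ (U : Theory.ModelType.{u, v, max u v w} T), AlephOneSaturated L U ∧
      ∃ x : B → U, ∀ φ ∈ Γ, φ.Realize x := by
  classical
  obtain ⟨N, x, hx1, hx2⟩ := exists_tm_model T Γ hΓ
  have hwit : ∀ (p : ℕ → Tm L B) (φ : L.Formula (ℕ ⊕ Fin 1)),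
      (∃ y : N, φ.Realize (Sum.elim (x ∘ p) fun _ => y)) →
      φ.Realize (Sum.elim (x ∘ p) fun _ => x (.node {φ} p)) := by
    intro p φ ⟨y, hy⟩
    refine hx2 p {φ} (fun Φ₀ hΦ₀ => ⟨y, fun ψ hψ => ?_⟩) φ rfl
    have : ψ = φ := hΦ₀ hψ
    exact this ▸ hy
  have hlift : ∀ {n : ℕ} (z : Fin n → N), (∀ i, z i ∈ Set.range x) →
      ∃ p : ℕ → Tm L B, ∀ i : Fin n, x (p i) = z i := by
    intro n z hz
    choose t ht using hz
    exact ⟨fun k => if h : k < n then t ⟨k, h⟩ else .base none, fun i => by simp [ht]⟩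
  let S : L.Substructure N :=
    { carrier := Set.range x
      fun_mem := by
        intro n f z hz
        obtain ⟨p, hp⟩ := hlift z hz
        let φ : L.Formula (ℕ ⊕ Fin 1) := Term.equal
          (Term.func f fun i : Fin n => Term.var (Sum.inl (i : ℕ))) (Term.var (Sum.inr 0))
        have hφ : ∀ y : N, φ.Realize (Sum.elim (x ∘ p) fun _ => y) ↔ funMap f z = y := by
          intro y
          simp only [φ, Formula.realize_equal, Term.realize_func, Term.realize_var, Sum.elim_inl,
            Sum.elim_inr, Function.comp_apply, hp]
        exact ⟨_, ((hφ _).1 (hwit p φ ⟨funMap f z, (hφ _).2 rfl⟩)).symm⟩ }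
  have hel : S.IsElementary := by
    apply S.isElementary_of_exists
    intro n φ z a ha
    obtain ⟨p, hp⟩ := hlift (fun i => (z i : N)) (fun i => (z i).2)
    let ψ : L.Formula (ℕ ⊕ Fin 1) := φ.toFormula.relabel
      (Sum.elim Empty.elim (Fin.snoc (α := fun _ => ℕ ⊕ Fin 1)
        (fun i : Fin n => Sum.inl (i : ℕ)) (Sum.inr 0)))
    have hψ : ∀ y : N, ψ.Realize (Sum.elim (x ∘ p) fun _ => y) ↔
        φ.Realize default (Fin.snoc ((↑) ∘ z) y : _ → N) := by
      intro y
      simp only [ψ, Formula.realize_relabel, BoundedFormula.realize_toFormula]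
      apply iff_of_eq
      congr 1
      · exact Subsingleton.elim _ _
      · funext i
        refine Fin.lastCases ?_ (fun i => ?_) i
        · simp
        · simp [hp]
    exact ⟨⟨_, _, rfl⟩, (hψ _).1 (hwit p ψ ⟨a, (hψ a).2 ha⟩)⟩
  let S' : L.ElementarySubstructure N := ⟨S, hel⟩
  have hne : Nonempty S' := ⟨⟨x (.base none), _, rfl⟩⟩
  refine ⟨Theory.ModelType.of T S', ?_, fun b => ⟨x (.base (some b)), _, rfl⟩, fun φ hφ => ?_⟩
  · intro p Φ hfin
    have hp : ∀ k, ∃ t, x t = (p k).1 := fun k => (p k).2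
    choose q hq using hp
    have hsum : ∀ y : S', (Sum.elim (x ∘ q) fun _ => (y : N)) =
        S'.subtype ∘ (Sum.elim p fun _ : Fin 1 => y) := by
      intro y
      funext k
      rcases k with k | k
      · exact hq k
      · rfl
    have := hx2 q Φ (fun Φ₀ hΦ₀ => by
      obtain ⟨y, hy⟩ := hfin Φ₀ hΦ₀
      refine ⟨y.1, fun φ hφ => ?_⟩
      rw [hsum y, S'.subtype.map_formula]
      exact hy φ hφ)
    refine ⟨⟨x (.node Φ q), _, rfl⟩, fun φ hφ => ?_⟩
    have h1 := this φ hφ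
    rw [hsum ⟨x (.node Φ q), _, rfl⟩, S'.subtype.map_formula] at h1
    exact h1
  · have := hx1 φ hφ
    exact (S'.subtype.map_formula φ (fun b => ⟨x (.base (some b)), _, rfl⟩)).1 this

end SRPaper

namespace SRPaper
universe u v

theorem term_eq_var {L : Language} (hL : ∀ l, IsEmpty (L.Functions l)) {n : ℕ}
    (t : L.Term (Fin n ⊕ Fin 0)) : ∃ i, t = Term.var (Sum.inl i) := by
  cases t with
  | var x =>
    rcases x with i | i
    · exact ⟨i, rfl⟩
    · exact i.elim0
  | func f ts => exact (hL _).elim f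

theorem sameQfTp_of {L : Language} (hL : ∀ l, IsEmpty (L.Functions l)) {M : Type*}
    [L.Structure M] {n : ℕ} {a b : Fin n → M} (h1 : ∀ i j, a i = a j ↔ b i = b j)
    (h2 : ∀ l (R : L.Relations l) (x : Fin l → Fin n),
      RelMap R (fun k => a (x k)) ↔ RelMap R (fun k => b (x k))) : SameQfTp L M a b := by
  intro φ hφ
  unfold Formula.Realize
  induction hφ with
  | falsum => rfl
  | of_isAtomic hat =>
    cases hat with
    | equal t1 t2 =>
      obtain ⟨i, rfl⟩ := term_eq_var hL t1
      obtain ⟨j, rfl⟩ := term_eq_var hL t2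
      simpa using h1 i j
    | rel R ts =>
      choose x hx using fun k => term_eq_var hL (ts k)
      obtain rfl : ts = fun k => Term.var (Sum.inl (x k)) := funext hx
      simpa [BoundedFormula.realize_rel] using h2 _ R x
  | imp _ _ i1 i2 =>
    simp only [BoundedFormula.realize_imp, i1, i2]

theorem SameQfTp.eq_iff {L : Language} {M : Type*}
    [L.Structure M] {n : ℕ} {a b : Fin n → M} (h : SameQfTp L M a b) (i j : Fin n) :
    a i = a j ↔ b i = b j := by
  have := h (Term.equal (Term.var i) (Term.var j))
    (BoundedFormula.IsQF.of_isAtomic (BoundedFormula.IsAtomic.equal _ _))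
  simpa using this

theorem SameQfTp.rel_iff {L : Language} {M : Type*}
    [L.Structure M] {n : ℕ} {a b : Fin n → M} (h : SameQfTp L M a b) {l} (R : L.Relations l)
    (x : Fin l → Fin n) :
    RelMap R (fun k => a (x k)) ↔ RelMap R (fun k => b (x k)) := by
  have := h (R.formula (fun k => Term.var (x k)))
    (BoundedFormula.IsQF.of_isAtomic (BoundedFormula.IsAtomic.rel _ _))
  simpa [Formula.realize_rel] using this

/-- Adjacency. -/
def gadj {G : Type} [langGr.Structure G] (x y : G) : Prop :=
  RelMap (L := langGr) GrSymb.adj ![x, y]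

theorem gadj_symm_irrefl (G : Type) [langGr.Structure G] [LinearOrder G] [Countable G]
    (hG : IsRandomOrderedGraph G) :
    (∀ x y : G, gadj x y → gadj y x) ∧ ∀ x : G, ¬ gadj x x := by
  letI : langOG.Structure G := inferInstanceAs ((langGr.sum Language.order).Structure G)
  have hemp : ∀ l, IsEmpty (langOG.Functions l) :=
    fun _ => inferInstanceAs (IsEmpty (Empty ⊕ Empty))
  have hage : langOG.age G =
      {N : CategoryTheory.Bundled langOG.Structure | Finite N ∧ IsOrderedGraph N} := hG.age
  have key : ∀ x y : G, (gadj x y → gadj y x) ∧ ¬ gadj x x := by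
    intro x y
    let S : langOG.Substructure G := Substructure.closure langOG {x, y}
    have hS : (⟨S, inferInstance⟩ : Bundled langOG.Structure) ∈ langOG.age G := by
      refine ⟨?_, ⟨S.subtype⟩⟩
      exact Substructure.fg_iff_structure_fg _ |>.1 (Substructure.fg_closure (by simp))
    rw [hage] at hS
    obtain ⟨-, h1, h2, -⟩ := hS
    let x' : S := ⟨x, Substructure.subset_closure (by simp)⟩
    let y' : S := ⟨y, Substructure.subset_closure (by simp)⟩
    have e : ∀ p q : S, RelMap (L := langOG) (Sum.inl GrSymb.adj) ![p, q] ↔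
        gadj (p : G) (q : G) := by
      intro p q
      have := S.subtype.map_rel (Sum.inl GrSymb.adj : langOG.Relations 2) ![p, q]
      rw [← this]
      have h3 : (S.subtype ∘ ![p, q]) = ![(p : G), q] := by
        funext k; fin_cases k <;> rfl
      rw [h3]
      rfl
    exact ⟨fun h => (e y' x').1 (h2 x' y' ((e x' y').2 h)), fun h => h1 x' ((e x' x').2 h)⟩
  exact ⟨fun x y => (key x y).1, fun x => (key x x).2⟩

theorem random_universal (G : Type) [langGr.Structure G] [LinearOrder G] [Countable G]
    (hG : IsRandomOrderedGraph G) (V : Type) [Finite V] [LinearOrder V] (A : V → V → Prop) :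
    ∃ e : V → G, StrictMono e ∧ ∀ x y, x < y → (gadj (e x) (e y) ↔ A x y) := by
  letI : langOG.Structure G := inferInstanceAs ((langGr.sum Language.order).Structure G)
  have hemp : ∀ l, IsEmpty (langOG.Functions l) :=
    fun _ => inferInstanceAs (IsEmpty (Empty ⊕ Empty))
  have hage : langOG.age G =
      {N : CategoryTheory.Bundled langOG.Structure | Finite N ∧ IsOrderedGraph N} := hG.age
  letI : langGr.Structure V :=
    { funMap := fun f _ => Empty.elim f
      RelMap := fun {n} r v => match n, r, v with
        | _, GrSymb.adj, v => (v 0 < v 1 ∧ A (v 0) (v 1)) ∨ (v 1 < v 0 ∧ A (v 1) (v 0)) }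
  letI : langOG.Structure V := inferInstanceAs ((langGr.sum Language.order).Structure V)
  have hV : (⟨V, inferInstance⟩ : Bundled langOG.Structure) ∈ langOG.age G := by
    rw [hage]
    refine ⟨‹_›, ?_, ?_, ?_⟩
    · intro x h
      have h : (x < x ∧ A x x) ∨ (x < x ∧ A x x) := h
      simp at h
    · intro x y h
      have h : (x < y ∧ A x y) ∨ (y < x ∧ A y x) := h
      show (y < x ∧ A y x) ∨ (x < y ∧ A x y)
      exact h.symm
    · exact inferInstanceAs (IsLinearOrder V (· ≤ ·))
  obtain ⟨-, ⟨f⟩⟩ := hV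
  have hf : ∀ {l} (R : langOG.Relations l) (x : Fin l → V), RelMap R (f ∘ x) ↔ RelMap R x :=
    fun R x => f.map_rel R x
  have hle : ∀ x y : V, f x ≤ f y ↔ x ≤ y := by
    intro x y
    exact hf (Sum.inr orderRel.le : langOG.Relations 2) ![x, y]
  refine ⟨f, ?_, ?_⟩
  · intro x y hxy
    rw [lt_iff_le_not_ge, hle, hle, ← lt_iff_le_not_ge]
    exact hxy
  · intro x y hxy
    have h1 := hf (Sum.inl GrSymb.adj : langOG.Relations 2) ![x, y]
    have h2 : (f ∘ ![x, y]) = ![f x, f y] := by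
      funext k; fin_cases k <;> rfl
    rw [h2] at h1
    have h3 : gadj (f x) (f y) ↔ (x < y ∧ A x y) ∨ (y < x ∧ A y x) := h1
    rw [h3]
    simp [hxy, hxy.not_gt]

end SRPaper

namespace SRPaper
universe u v

section SD
variable {I : Type} [langGr.Structure I] [LinearOrder I] {M : I → Type}
  [∀ i, langGr.Structure (M i)] [∀ i, LinearOrder (M i)]

/-- The class of a point. -/
def cls (p : Σₗ i, M i) : I := (ofLex p).1

/-- The fiberwise adjacency. -/
def r1 (p q : Σₗ i, M i) : Prop :=
  ∃ (i : I) (a b : M i), p = toLex ⟨i, a⟩ ∧ q = toLex ⟨i, b⟩ ∧ gadj a b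

theorem relMap_two {N : Type*} {L : Language} [L.Structure N] (R : L.Relations 2) (w : Fin 2 → N) :
    RelMap R w ↔ RelMap R ![w 0, w 1] := by
  have : w = ![w 0, w 1] := by funext k; fin_cases k <;> rfl
  exact iff_of_eq (congrArg _ this)

theorem sd_r1 (w : Fin 2 → Σₗ i, M i) :
    RelMap (L := langSD langGr langGr) (Sum.inl (Sum.inl (Sum.inl GrSymb.adj))) w ↔
      r1 (w 0) (w 1) := by
  constructor
  · rintro ⟨i, x, hx, h⟩
    exact ⟨i, x 0, x 1, hx 0, hx 1, (relMap_two (L := langGr) _ _).1 h⟩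
  · rintro ⟨i, a, b, ha, hb, h⟩
    refine ⟨i, ![a, b], ?_, h⟩
    intro k
    fin_cases k
    · exact ha
    · exact hb

theorem sd_le (w : Fin 2 → Σₗ i, M i) :
    RelMap (L := langSD langGr langGr) (Sum.inl (Sum.inl (Sum.inr orderRel.le))) w ↔
      w 0 ≤ w 1 := Iff.rfl

theorem sd_E (w : Fin 2 → Σₗ i, M i) :
    RelMap (L := langSD langGr langGr) (Sum.inl (Sum.inr EqSymb.E)) w ↔
      cls (w 0) = cls (w 1) := Iff.rfl

theorem sd_r2 (w : Fin 2 → Σₗ i, M i) :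
    RelMap (L := langSD langGr langGr) (Sum.inr GrSymb.adj) w ↔
      gadj (cls (w 0)) (cls (w 1)) := relMap_two (L := langGr) _ _

theorem eo_le (w : Fin 2 → Σₗ i, M i) :
    RelMap (L := langEO) (Sum.inr orderRel.le) w ↔ w 0 ≤ w 1 := Iff.rfl

theorem eo_E (w : Fin 2 → Σₗ i, M i) :
    RelMap (L := langEO) (Sum.inl EqSymb.E) w ↔ cls (w 0) = cls (w 1) := Iff.rfl

theorem cls_mono {p q : Σₗ i, M i} (h : p ≤ q) : cls p ≤ cls q := by
  rcases Sigma.Lex.le_def.1 h with h | ⟨h, -⟩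
  · exact h.le
  · exact h.le

theorem lt_of_cls_lt {p q : Σₗ i, M i} (h : cls p < cls q) : p < q :=
  Sigma.Lex.lt_def.2 (Or.inl h)

theorem r1_cls {p q : Σₗ i, M i} (h : r1 p q) : cls p = cls q := by
  obtain ⟨i, a, b, rfl, rfl, h⟩ := h
  rfl

theorem r1_mk {i : I} {a b : M i} : r1 (toLex ⟨i, a⟩) (toLex ⟨i, b⟩) ↔ gadj a b := by
  constructor
  · rintro ⟨j, a', b', ha, hb, h⟩
    have ha := toLex.injective ha
    have hb := toLex.injective hb
    cases ha
    cases hb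
    exact h
  · exact fun h => ⟨i, a, b, rfl, rfl, h⟩

variable [Countable I] [∀ i, Countable (M i)]

theorem r1_symm (hM : ∀ i, IsRandomOrderedGraph (M i)) {p q : Σₗ i, M i} (h : r1 p q) :
    r1 q p := by
  obtain ⟨i, a, b, rfl, rfl, h⟩ := h
  exact ⟨i, b, a, rfl, rfl, (gadj_symm_irrefl _ (hM i)).1 _ _ h⟩

theorem r1_irrefl (hM : ∀ i, IsRandomOrderedGraph (M i)) (p : Σₗ i, M i) : ¬ r1 p p := by
  rintro ⟨i, a, b, rfl, hab, h⟩
  have hab := toLex.injective hab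
  cases hab
  exact (gadj_symm_irrefl _ (hM i)).2 _ h

theorem sd_same (hI : IsRandomOrderedGraph I) (hM : ∀ i, IsRandomOrderedGraph (M i)) {n : ℕ}
    {a b : Fin n → Σₗ i, M i} (hlt : ∀ s t, a s < a t ↔ b s < b t)
    (hc : ∀ s t, cls (a s) = cls (a t) ↔ cls (b s) = cls (b t))
    (h1 : ∀ s t, a s < a t → cls (a s) = cls (a t) → (r1 (a s) (a t) ↔ r1 (b s) (b t)))
    (h2 : ∀ s t, cls (a s) < cls (a t) →
      (gadj (cls (a s)) (cls (a t)) ↔ gadj (cls (b s)) (cls (b t)))) :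
    SameQfTp (langSD langGr langGr) (Σₗ i, M i) a b := by
  have heq : ∀ s t, a s = a t ↔ b s = b t := by
    intro s t
    have h3 := hlt s t
    have h4 := hlt t s
    constructor
    · intro h
      rw [h] at h3 h4
      simp only [lt_self_iff_false, false_iff, not_lt] at h3 h4
      exact le_antisymm h4 h3
    · intro h
      rw [h] at h3 h4
      simp only [lt_self_iff_false, iff_false, not_lt] at h3 h4
      exact le_antisymm h4 h3
  have h1' : ∀ s t, r1 (a s) (a t) ↔ r1 (b s) (b t) := by
    intro s t
    by_cases hcl : cls (a s) = cls (a t)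
    · rcases lt_trichotomy (a s) (a t) with h | h | h
      · exact h1 s t h hcl
      · have h' := (heq s t).1 h
        rw [h, h']
        exact iff_of_false (r1_irrefl hM _) (r1_irrefl hM _)
      · have := h1 t s h hcl.symm
        exact ⟨fun h => r1_symm hM (this.1 (r1_symm hM h)),
          fun h => r1_symm hM (this.2 (r1_symm hM h))⟩
    · exact iff_of_false (fun h => hcl (r1_cls h)) (fun h => hcl ((hc s t).2 (r1_cls h)))
  have h2' : ∀ s t, gadj (cls (a s)) (cls (a t)) ↔ gadj (cls (b s)) (cls (b t)) := by
    intro s t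
    have hsi := gadj_symm_irrefl _ hI
    rcases lt_trichotomy (cls (a s)) (cls (a t)) with h | h | h
    · exact h2 s t h
    · have h' := (hc s t).1 h
      rw [h, h']
      exact iff_of_false (hsi.2 _) (hsi.2 _)
    · have := h2 t s h
      exact ⟨fun h => hsi.1 _ _ (this.1 (hsi.1 _ _ h)), fun h => hsi.1 _ _ (this.2 (hsi.1 _ _ h))⟩
  refine sameQfTp_of (fun l => inferInstanceAs (IsEmpty (((Empty ⊕ Empty) ⊕ Empty) ⊕ Empty)))
    heq ?_
  intro l R x
  rcases R with ((R | R) | R) | R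
  · cases R
    exact (sd_r1 _).trans ((h1' _ _).trans (sd_r1 (fun k => b (x k))).symm)
  · cases R
    refine (sd_le _).trans (Iff.trans ?_ (sd_le (fun k => b (x k))).symm)
    rw [← not_lt, ← not_lt]
    exact not_congr (hlt _ _)
  · cases R
    exact (sd_E _).trans ((hc _ _).trans (sd_E (fun k => b (x k))).symm)
  · cases R
    exact (sd_r2 _).trans ((h2' _ _).trans (sd_r2 (fun k => b (x k))).symm)

theorem sd_data {n : ℕ} {a b : Fin n → Σₗ i, M i}
    (h : SameQfTp (langSD langGr langGr) (Σₗ i, M i) a b) (s t : Fin n) :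
    (cls (a s) = cls (a t) ↔ cls (b s) = cls (b t)) ∧
    (cls (a s) < cls (a t) ↔ cls (b s) < cls (b t)) ∧
    (gadj (cls (a s)) (cls (a t)) ↔ gadj (cls (b s)) (cls (b t))) := by
  have hE := (sd_E _).symm.trans ((h.rel_iff (L := langSD langGr langGr)
    (Sum.inl (Sum.inr EqSymb.E)) ![s, t]).trans (sd_E _))
  have h2 := (sd_r2 _).symm.trans ((h.rel_iff (L := langSD langGr langGr)
    (Sum.inr GrSymb.adj) ![s, t]).trans (sd_r2 _))
  have hle := (sd_le _).symm.trans ((h.rel_iff (L := langSD langGr langGr)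
    (Sum.inl (Sum.inl (Sum.inr orderRel.le))) ![s, t]).trans (sd_le _))
  have hE : cls (a s) = cls (a t) ↔ cls (b s) = cls (b t) := hE
  have hle : a s ≤ a t ↔ b s ≤ b t := hle
  refine ⟨hE, ?_, h2⟩
  constructor
  · intro h3
    exact lt_of_le_of_ne (cls_mono (hle.1 (lt_of_cls_lt h3).le)) (fun h4 => h3.ne (hE.2 h4))
  · intro h3
    exact lt_of_le_of_ne (cls_mono (hle.2 (lt_of_cls_lt h3).le)) (fun h4 => h3.ne (hE.1 h4))

theorem eo_data {n : ℕ} {a b : Fin n → Σₗ i, M i}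
    (h : SameQfTp langEO (Σₗ i, M i) a b) (s t : Fin n) :
    (cls (a s) = cls (a t) ↔ cls (b s) = cls (b t)) ∧
    (a s < a t ↔ b s < b t) := by
  have hE := (eo_E _).symm.trans ((h.rel_iff (L := langEO)
    (Sum.inl EqSymb.E) ![s, t]).trans (eo_E _))
  have hle := (eo_le _).symm.trans ((h.rel_iff (L := langEO)
    (Sum.inr orderRel.le) ![t, s]).trans (eo_le _))
  have hle : a t ≤ a s ↔ b t ≤ b s := hle
  refine ⟨hE, ?_⟩
  rw [← not_le, ← not_le]
  exact not_congr hle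

theorem eo_same {n : ℕ}
    {a b : Fin n → Σₗ i, M i} (heq : ∀ s t, a s = a t ↔ b s = b t)
    (hle : ∀ s t, a s ≤ a t ↔ b s ≤ b t)
    (hc : ∀ s t, cls (a s) = cls (a t) ↔ cls (b s) = cls (b t)) :
    SameQfTp langEO (Σₗ i, M i) a b := by
  refine sameQfTp_of (fun l => inferInstanceAs (IsEmpty (Empty ⊕ Empty))) heq ?_
  intro l R x
  rcases R with R | R
  · cases R
    exact (eo_E _).trans ((hc _ _).trans (eo_E (fun k => b (x k))).symm)
  · cases R
    exact (eo_le _).trans ((hle _ _).trans (eo_le (fun k => b (x k))).symm)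

theorem flat_realize (hI : IsRandomOrderedGraph I) (hM : ∀ i, IsRandomOrderedGraph (M i))
    (V C : Type) [Finite V] [Finite C] [LinearOrder V] [LinearOrder C] (π : V → C)
    (hπ : Monotone π) (G1 : V → V → Prop) (G2 : C → C → Prop) :
    ∃ e : V → Σₗ i, M i, StrictMono e ∧ (∀ x y, cls (e x) = cls (e y) ↔ π x = π y) ∧
      (∀ x y, x < y → π x = π y → (r1 (e x) (e y) ↔ G1 x y)) ∧
      ∀ x y, π x < π y → (gadj (cls (e x)) (cls (e y)) ↔ G2 (π x) (π y)) := by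
  obtain ⟨f, hf, hf2⟩ := random_universal I hI C G2
  have hg : ∀ c : C, ∃ g : {v // π v = c} → M (f c), StrictMono g ∧
      ∀ x y, x < y → (gadj (g x) (g y) ↔ G1 x y) := fun c =>
    random_universal (M (f c)) (hM _) {v // π v = c} (fun x y => G1 x y)
  choose g hg1 hg2 using hg
  have hkey : ∀ (c : C) (x : V) (h : π x = c),
      (toLex ⟨f (π x), g (π x) ⟨x, rfl⟩⟩ : Σₗ i, M i) = toLex ⟨f c, g c ⟨x, h⟩⟩ := by
    rintro c x rfl
    rfl
  refine ⟨fun x => toLex ⟨f (π x), g (π x) ⟨x, rfl⟩⟩, ?_, ?_, ?_, ?_⟩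
  · intro x y hxy
    rcases (hπ hxy.le).lt_or_eq with h | h
    · exact lt_of_cls_lt (hf h)
    · show (toLex ⟨f (π x), g (π x) ⟨x, rfl⟩⟩ : Σₗ i, M i) < _
      rw [hkey (π y) x h]
      refine Sigma.Lex.lt_def.2 (Or.inr ⟨rfl, ?_⟩)
      exact hg1 (π y) hxy
  · intro x y
    exact hf.injective.eq_iff
  · intro x y hxy h
    show r1 (toLex ⟨f (π x), g (π x) ⟨x, rfl⟩⟩) _ ↔ _
    rw [hkey (π y) x h, r1_mk]
    exact hg2 (π y) ⟨x, h⟩ ⟨y, rfl⟩ hxy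
  · intro x y h
    exact hf2 _ _ h

end SD
end SRPaper

namespace SRPaper
universe u v

/-- Same ordered graph pattern. -/
def Pat {I : Type} [langGr.Structure I] [LinearOrder I] {n : ℕ} (ι κ : Fin n → I) : Prop :=
  ∀ s t, (ι s = ι t ↔ κ s = κ t) ∧ (ι s < ι t ↔ κ s < κ t) ∧
    (ι s < ι t → (gadj (ι s) (ι t) ↔ gadj (κ s) (κ t)))

theorem indisc_config {I : Type} [langGr.Structure I] [LinearOrder I]
    {L : FirstOrder.Language.{u, v}} {N : Type*} [L.Structure N] [Nonempty N] {d : ℕ}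
    (ψ : (Fin d → N) → (Fin d → N) → Prop)
    (H : ∀ (V : Type) [Finite V] (adj : V → V → Prop), ∃ cc : V → Fin d → N,
      ∀ u v, ψ (cc u) (cc v) ↔ adj u v)
    (m : ℕ) (nn : Fin m → ℕ) (φ : ∀ k, L.Formula (Fin (nn k) × Fin d)) (B : Finset I) :
    ∃ x : I → Fin d → N, (∀ i ∈ B, ∀ j ∈ B, i < j → (ψ (x i) (x j) ↔ gadj i j)) ∧
      ∀ k, ∀ ι κ : Fin (nn k) → I, (∀ r, ι r ∈ B) → (∀ r, κ r ∈ B) → Pat ι κ →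
        (((φ k).Realize fun p => x (ι p.1) p.2) ↔ ((φ k).Realize fun p => x (κ p.1) p.2)) := by
  classical
  let b := B.card
  let e0 : Fin b ≃o B := B.orderIsoOfFin rfl
  let G : Fin b → Fin b → Prop := fun s t => gadj (e0 s : I) (e0 t : I)
  obtain ⟨V, hV, adj, hram⟩ := graph_ramsey (∀ k, Set (Fin (nn k) → Fin b)) b G
  obtain ⟨cc, hcc⟩ := H V adj
  obtain ⟨e, he1, he2⟩ := hram (fun a x k =>
    {σ | ∃ h : ∀ r, (σ r).1 < a, (φ k).Realize fun p => cc (x ⟨σ p.1, h _⟩) p.2})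
  let x : I → Fin d → N := fun i =>
    if h : i ∈ B then cc (e (e0.symm ⟨i, h⟩)) else fun _ => Classical.arbitrary N
  have hx : ∀ s : Fin b, x (e0 s) = cc (e s) := by
    intro s
    simp only [x]
    rw [dif_pos (e0 s).2]
    simp
  have hsurj : ∀ i ∈ B, ∃ s, (e0 s : I) = i := fun i hi => ⟨e0.symm ⟨i, hi⟩, by simp⟩
  refine ⟨x, ?_, ?_⟩
  · intro i hi j hj hij
    obtain ⟨s, rfl⟩ := hsurj i hi
    obtain ⟨t, rfl⟩ := hsurj j hj
    rw [hx, hx, hcc]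
    exact he1 s t (e0.lt_iff_lt.1 hij)
  · intro k ι κ hι hκ hpat
    choose ι' hι' using fun r => hsurj (ι r) (hι r)
    choose κ' hκ' using fun r => hsurj (κ r) (hκ r)
    have hp : ∀ s t, (ι' s = ι' t ↔ κ' s = κ' t) ∧ (ι' s < ι' t ↔ κ' s < κ' t) ∧
        (ι' s < ι' t → (G (ι' s) (ι' t) ↔ G (κ' s) (κ' t))) := by
      intro s t
      obtain ⟨h1, h2, h3⟩ := hpat s t
      simp only [← hι', ← hκ', Subtype.coe_lt_coe, SetLike.coe_eq_coe, OrderIso.lt_iff_lt,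
        EmbeddingLike.apply_eq_iff_eq] at h1 h2 h3
      exact ⟨h1, h2, h3⟩
    let R := Finset.univ.image ι'
    let a := R.card
    have hab : a ≤ b := by simpa using Finset.card_le_univ R
    let j : Fin a ≃o R := R.orderIsoOfFin rfl
    let je : Fin a ↪o Fin b := j.toOrderEmbedding.trans (OrderEmbedding.subtype (· ∈ R))
    have hje : ∀ s, je s = (j s : Fin b) := fun s => rfl
    have hsec : ∀ s : Fin a, ∃ r, ι' r = je s := by
      intro s
      have := (j s).2
      simp only [R, Finset.mem_image, Finset.mem_univ, true_and] at this
      exact this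
    choose sec hsec using hsec
    let je' : Fin a ↪o Fin b := OrderEmbedding.ofStrictMono (fun s => κ' (sec s)) (by
      intro s t hst
      apply (hp _ _).2.1.1
      rw [hsec, hsec]
      exact je.lt_iff_lt.2 hst)
    have hje' : ∀ s, je' s = κ' (sec s) := fun s => rfl
    have hc := he2 a je je' (by
      intro s t hst
      rw [hje', hje', ← hsec, ← hsec]
      apply (hp _ _).2.2
      rw [hsec, hsec]
      exact je.lt_iff_lt.2 hst)
    let ρ : Fin (nn k) → Fin a := fun r => j.symm ⟨ι' r, Finset.mem_image_of_mem _ (Finset.mem_univ _)⟩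
    have hρ : ∀ r, je (ρ r) = ι' r := by
      intro r
      simp [hje, ρ]
    have hρ' : ∀ r, je' (ρ r) = κ' r := by
      intro r
      rw [hje', ← (hp _ _).1, hsec, hρ]
    let σ : Fin (nn k) → Fin b := fun r => Fin.castLE hab (ρ r)
    have hmem := congrArg (fun S : ∀ k, Set (Fin (nn k) → Fin b) => σ ∈ S k) hc
    have hσ : ∀ r, (σ r).1 < a := fun r => (ρ r).2
    have hfin : ∀ f : Fin a → V,
        (∃ h : ∀ r, (σ r).1 < a, (φ k).Realize fun p => cc (f ⟨σ p.1, h _⟩) p.2) ↔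
        (φ k).Realize fun p => cc (f (ρ p.1)) p.2 :=
      fun f => ⟨fun ⟨_, h⟩ => h, fun h => ⟨hσ, h⟩⟩
    have hmem' := (hfin _).symm.trans ((iff_of_eq hmem).trans (hfin _))
    simp only [Function.comp_apply, hρ, hρ'] at hmem'
    simp only [← hι', ← hκ', hx]
    exact hmem'

theorem ip_config {L : FirstOrder.Language.{u, v}} {N : Type*} [L.Structure N] {nx ny : ℕ}
    (φ : L.Formula (Fin nx ⊕ Fin ny)) (aa : ℕ → Fin nx → N) (bb : Set ℕ → Fin ny → N)
    (h : ∀ (i : ℕ) (S : Set ℕ), (φ.Realize (Sum.elim (aa i) (bb S)) ↔ i ∈ S))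
    (V : Type) [Finite V] (adj : V → V → Prop) : ∃ cc : V → Fin (nx + ny) → N,
      ∀ u v, φ.Realize (Sum.elim (fun s => cc u (Fin.castAdd ny s))
        (fun s => cc v (Fin.natAdd nx s))) ↔ adj u v := by
  obtain ⟨n, ⟨eq⟩⟩ := Finite.exists_equiv_fin V
  refine ⟨fun v => Fin.append (aa (eq v)) (bb {k | ∃ u, adj u v ∧ ((eq u : Fin n) : ℕ) = k}), ?_⟩
  intro u v
  simp only [Fin.append_left, Fin.append_right]
  rw [show (fun s => aa (eq u) s) = aa (eq u) from rfl, h]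
  constructor
  · rintro ⟨u', h1, h2⟩
    have : u' = u := eq.injective (Fin.ext h2)
    exact this ▸ h1
  · exact fun h => ⟨u, h, rfl⟩

theorem ip_not_collapse {I : Type} [langGr.Structure I] [LinearOrder I] [Countable I]
    (hI : IsRandomOrderedGraph I)
    {M : I → Type} [∀ i, langGr.Structure (M i)] [∀ i, LinearOrder (M i)]
    [∀ i, Countable (M i)] (hM : ∀ i, IsRandomOrderedGraph (M i))
    (L : FirstOrder.Language.{u, v}) (T : L.Theory) (hip : HasIP L T) :
      ∃ (U : Theory.ModelType.{u, v, max u v} T) (_ : AlephOneSaturated L U) (d : ℕ)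
        (X : (Σₗ i, M i) → Fin d → U),
        IndexedIndiscernible (langSD langGr langGr) (Σₗ i, M i) L U d X ∧
        ¬ IndexedIndiscernible langEO (Σₗ i, M i) L U d X := by
  classical
  obtain ⟨nx, ny, φ, N, aa, bb, hφ⟩ := hip
  let d := nx + ny
  let ax1 : ∀ n : ℕ, (Fin n → I) → (Fin n → I) → L.Formula (Fin n × Fin d) → L.Formula (I × Fin d) :=
    fun n ι κ θ => (θ.relabel (fun p => (ι p.1, p.2))).iff (θ.relabel (fun p => (κ p.1, p.2)))
  let ax2 : I → I → L.Formula (I × Fin d) := fun i j =>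
    φ.relabel (Sum.elim (fun s => (i, Fin.castAdd ny s)) (fun s => (j, Fin.natAdd nx s)))
  let P1 : L.Formula (I × Fin d) → Finset I → (n : ℕ) → L.Formula (Fin n × Fin d) → Prop :=
    fun χ F n θ => ∃ (ι κ : Fin n → I), (∀ r, ι r ∈ F) ∧ (∀ r, κ r ∈ F) ∧
      Pat ι κ ∧ χ = ax1 n ι κ θ
  let P2 : L.Formula (I × Fin d) → Finset I → Prop := fun χ F =>
    ∃ i ∈ F, ∃ j ∈ F, i < j ∧ ((gadj i j ∧ χ = ax2 i j) ∨ (¬ gadj i j ∧ χ = (ax2 i j).not))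
  let Γ : Set (L.Formula (I × Fin d)) := {χ | ∃ F n θ, P1 χ F n θ ∨ P2 χ F}
  have hfin : ∀ Γ₀ : Finset (L.Formula (I × Fin d)), ↑Γ₀ ⊆ Γ →
      ∃ (N : Theory.ModelType.{u, v, max u v} T) (x : I × Fin d → N), ∀ χ ∈ Γ₀, χ.Realize x := by
    intro Γ₀ hΓ₀
    choose F n θ hP using fun χ : Γ₀ => hΓ₀ χ.2
    let B : Finset I := Finset.univ.biUnion F
    have hB : ∀ χ, ∀ i ∈ F χ, i ∈ B := fun χ i hi =>
      Finset.mem_biUnion.2 ⟨χ, Finset.mem_univ _, hi⟩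
    let eq := Γ₀.equivFin
    obtain ⟨x, hx1, hx2⟩ := indisc_config (I := I) (L := L) (N := N) (d := d)
      (fun f g => φ.Realize (Sum.elim (fun s => f (Fin.castAdd ny s))
        (fun s => g (Fin.natAdd nx s)))) (fun V _ adj => ip_config φ aa bb hφ V adj)
      Γ₀.card (fun k => n (eq.symm k)) (fun k => θ (eq.symm k)) B
    refine ⟨N, fun p => x p.1 p.2, fun χ hχ => ?_⟩
    have hax2 : ∀ i j, (ax2 i j).Realize (fun p => x p.1 p.2) ↔
        φ.Realize (Sum.elim (fun s => x i (Fin.castAdd ny s))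
        (fun s => x j (Fin.natAdd nx s))) := by
      intro i j
      simp only [ax2, Formula.realize_relabel]
      apply iff_of_eq
      congr 1
      funext s
      rcases s with s | s <;> rfl
    have h2 : ∀ χ : Γ₀, ∀ ι κ : Fin (n χ) → I, (∀ r, ι r ∈ B) → (∀ r, κ r ∈ B) → Pat ι κ →
        (((θ χ).Realize fun p => x (ι p.1) p.2) ↔ ((θ χ).Realize fun p => x (κ p.1) p.2)) := by
      intro χ
      obtain ⟨k, rfl⟩ := eq.symm.surjective χ
      exact hx2 k
    rcases hP ⟨χ, hχ⟩ with ⟨ι, κ, hι, hκ, hpat, h⟩ | ⟨i, hi, j, hj, hij, h⟩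
    · have h3 := h2 ⟨χ, hχ⟩ ι κ (fun r => hB _ _ (hι r)) (fun r => hB _ _ (hκ r)) hpat
      have h : χ = _ := h
      rw [h]
      simp only [ax1, Formula.realize_iff, Formula.realize_relabel]
      exact h3
    · have h3 := hx1 i (hB _ _ hi) j (hB _ _ hj) hij
      rcases h with ⟨hg, h⟩ | ⟨hg, h⟩
      · have h : χ = _ := h
        rw [h, hax2, h3]
        exact hg
      · have h : χ = _ := h
        rw [h, Formula.realize_not, hax2, h3]
        exact hg
  obtain ⟨U, hU, x, hx⟩ := exists_saturated.{u, v, 0, max u v} T Γ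
    (compactness_formulas.{u, v, 0, max u v} T Γ hfin)
  have hc : ∀ n (ι κ : Fin n → I) (θ : L.Formula (Fin n × Fin d)), Pat ι κ →
      ((θ.Realize fun p => x (ι p.1, p.2)) ↔ (θ.Realize fun p => x (κ p.1, p.2))) := by
    intro n ι κ θ hpat
    have := hx (ax1 n ι κ θ) ⟨Finset.univ.image ι ∪ Finset.univ.image κ, n, θ, Or.inl
      ⟨ι, κ, by simp, by simp, hpat, rfl⟩⟩
    simp only [ax1, Formula.realize_iff, Formula.realize_relabel] at this
    exact this
  have hc2 : ∀ i j, i < j → ((ax2 i j).Realize x ↔ gadj i j) := by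
    intro i j hij
    by_cases hg : gadj i j
    · exact iff_of_true (hx _ ⟨{i, j}, 0, ⊥, Or.inr ⟨i, by simp, j, by simp, hij, Or.inl ⟨hg, rfl⟩⟩⟩) hg
    · have := hx _ ⟨{i, j}, 0, ⊥, Or.inr ⟨i, by simp, j, by simp, hij, Or.inr ⟨hg, rfl⟩⟩⟩
      rw [Formula.realize_not] at this
      exact iff_of_false this hg
  refine ⟨U, hU, d, fun p s => x (cls p, s), ?_, ?_⟩
  · intro n ι κ hs θ
    exact hc n (fun r => cls (ι r)) (fun r => cls (κ r)) θ
      (fun s t => ⟨(sd_data hs s t).1, (sd_data hs s t).2.1, fun _ => (sd_data hs s t).2.2⟩)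
  · intro hO
    have hpts : ∀ b : Prop, ∃ e : Fin 2 → Σₗ i, M i, cls (e 0) < cls (e 1) ∧
        (gadj (cls (e 0)) (cls (e 1)) ↔ b) := by
      intro b
      obtain ⟨e, he, hcl, -, h⟩ := flat_realize hI hM (Fin 2) (Fin 2) id monotone_id
        (fun _ _ => True) (fun _ _ => b)
      refine ⟨e, ?_, h 0 1 (by simp)⟩
      refine lt_of_le_of_ne (cls_mono (he (by simp)).le) ?_
      intro h
      have := (hcl 0 1).1 h
      simp at this
    obtain ⟨e, he, hg⟩ := hpts True
    obtain ⟨e', he', hg'⟩ := hpts False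
    have hs : SameQfTp langEO (Σₗ i, M i) e e' := by
      have q1 := lt_of_cls_lt he
      have q2 := lt_of_cls_lt he'
      apply eo_same
      · intro s t
        fin_cases s <;> fin_cases t <;> simp [q1.ne, q2.ne, q1.ne', q2.ne']
      · intro s t
        fin_cases s <;> fin_cases t <;> simp [q1.le, q2.le, q1.not_ge, q2.not_ge]
      · intro s t
        fin_cases s <;> fin_cases t <;> simp [he.ne, he'.ne, he.ne', he'.ne']
    have h1 := hO 2 e e' hs (φ.relabel (Sum.elim (fun s => (0, Fin.castAdd ny s))
      (fun s => (1, Fin.natAdd nx s))))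
    have h2 := hc2 _ _ he
    have h3 := hc2 _ _ he'
    simp only [ax2, Formula.realize_relabel] at h1 h2 h3
    have key : ∀ f : Fin 2 → Σₗ i, M i,
      ((fun p : Fin 2 × Fin d => x (cls (f p.1), p.2)) ∘
        (Sum.elim (fun s => (0, Fin.castAdd ny s)) (fun s => (1, Fin.natAdd nx s)) :
          Fin nx ⊕ Fin ny → Fin 2 × Fin d)) =
      x ∘ (Sum.elim (fun s => (cls (f 0), Fin.castAdd ny s))
        (fun s => (cls (f 1), Fin.natAdd nx s))) := by
      intro f
      funext s
      rcases s with s | s <;> rfl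
    rw [key, key, h2, h3, hg, hg'] at h1
    simp at h1

end SRPaper

namespace SRPaper
universe u v

universe w'

open Classical in
theorem ip_of_shatter {L : FirstOrder.Language.{u, v}} (T : L.Theory)
    (N : Theory.ModelType.{u, v, w'} T) {W : Type} [Finite W] (φ : L.Formula W) (Q : W → Prop)
    (h : ∀ n : ℕ, ∃ (A : Fin n → W → N) (B : Set (Fin n) → W → N), ∀ i S,
      φ.Realize (fun w => if Q w then A i w else B S w) ↔ i ∈ S) : HasIP L T := by
  obtain ⟨r, ⟨eW⟩⟩ := Finite.exists_equiv_fin W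
  let φ' : L.Formula (Fin r ⊕ Fin r) :=
    φ.relabel (fun w => if Q w then Sum.inl (eW w) else Sum.inr (eW w))
  let ax : ℕ → Set ℕ → L.Formula ((ℕ × Fin r) ⊕ (Set ℕ × Fin r)) := fun i S =>
    φ'.relabel (Sum.elim (fun s => Sum.inl (i, s)) (fun s => Sum.inr (S, s)))
  let ax' : ℕ → Set ℕ → L.Formula ((ℕ × Fin r) ⊕ (Set ℕ × Fin r)) := fun i S =>
    if i ∈ S then ax i S else (ax i S).not
  let Γ : Set (L.Formula ((ℕ × Fin r) ⊕ (Set ℕ × Fin r))) := {χ | ∃ i S, χ = ax' i S}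
  obtain ⟨N', x, hx⟩ := compactness_formulas.{u, v, 0, w'} T Γ (by
    intro Γ₀ hΓ₀
    choose I S hIS using fun χ : Γ₀ => hΓ₀ χ.2
    let n := (Finset.univ : Finset Γ₀).sup I
    have hn : ∀ χ, I χ ≤ n := fun χ => Finset.le_sup (Finset.mem_univ χ)
    obtain ⟨A, B, hAB⟩ := h (n + 1)
    let tr : ℕ → Fin (n + 1) := fun i => if h : i < n + 1 then ⟨i, h⟩ else 0
    have htr : ∀ χ, (tr (I χ) : ℕ) = I χ := by
      intro χ
      simp only [tr]
      rw [dif_pos (Nat.lt_succ_of_le (hn χ))]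
    refine ⟨N, Sum.elim (fun p => A (tr p.1) (eW.symm p.2))
      (fun p => B {k | (k : ℕ) ∈ p.1} (eW.symm p.2)), fun χ hχ => ?_⟩
    have h1 : χ = _ := hIS ⟨χ, hχ⟩
    have h2 := hAB (tr (I ⟨χ, hχ⟩)) {k | (k : ℕ) ∈ S ⟨χ, hχ⟩}
    rw [Set.mem_setOf_eq, htr] at h2
    have h3 : (ax (I ⟨χ, hχ⟩) (S ⟨χ, hχ⟩)).Realize
        (Sum.elim (fun p => A (tr p.1) (eW.symm p.2))
          (fun p => B {k | (k : ℕ) ∈ p.1} (eW.symm p.2))) ↔ I ⟨χ, hχ⟩ ∈ S ⟨χ, hχ⟩ := by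
      rw [← h2]
      simp only [ax, φ', Formula.realize_relabel]
      apply iff_of_eq
      congr 1
      funext w
      by_cases hw : Q w <;> simp [hw]
    rw [h1]
    by_cases hm : I ⟨χ, hχ⟩ ∈ S ⟨χ, hχ⟩
    · simp only [ax', if_pos hm]
      exact h3.2 hm
    · simp only [ax', if_neg hm, Formula.realize_not]
      exact fun h => hm (h3.1 h))
  refine ⟨r, r, φ', N', fun i s => x (Sum.inl (i, s)), fun S s => x (Sum.inr (S, s)), ?_⟩
  intro i S
  have h1 := hx _ ⟨i, S, rfl⟩
  have h2 : φ'.Realize (Sum.elim (fun s => x (Sum.inl (i, s))) (fun s => x (Sum.inr (S, s)))) ↔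
      (ax i S).Realize x := by
    simp only [ax, Formula.realize_relabel]
    apply iff_of_eq
    congr 1
    funext s
    rcases s with s | s <;> rfl
  rw [h2]
  by_cases hm : i ∈ S
  · simp only [ax', if_pos hm] at h1
    exact iff_of_true h1 hm
  · simp only [ax', if_neg hm, Formula.realize_not] at h1
    exact iff_of_false h1 hm

section Main
variable {I : Type} [langGr.Structure I] [LinearOrder I] [Countable I]
    {M : I → Type} [∀ i, langGr.Structure (M i)] [∀ i, LinearOrder (M i)]
    [∀ i, Countable (M i)]

/-- `e` realizes the pattern `S`. -/
def Rz {V C : Type} [LinearOrder V] [LinearOrder C] (π : V → C)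
    (S : Set ((V × V) ⊕ (C × C))) (e : V → Σₗ i, M i) : Prop :=
  StrictMono e ∧ (∀ x y, cls (e x) = cls (e y) ↔ π x = π y) ∧
    (∀ x y, x < y → π x = π y → (r1 (e x) (e y) ↔ Sum.inl (x, y) ∈ S)) ∧
    ∀ x y, π x < π y → (gadj (cls (e x)) (cls (e y)) ↔ Sum.inr (π x, π y) ∈ S)

theorem Rz.exists (hI : IsRandomOrderedGraph I) (hM : ∀ i, IsRandomOrderedGraph (M i))
    {V C : Type} [Finite V] [Finite C] [LinearOrder V] [LinearOrder C] {π : V → C}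
    (hπ : Monotone π) (S : Set ((V × V) ⊕ (C × C))) : ∃ e : V → Σₗ i, M i, Rz π S e :=
  flat_realize hI hM V C π hπ (fun x y => Sum.inl (x, y) ∈ S) (fun x y => Sum.inr (x, y) ∈ S)

theorem Rz.congr {V C : Type} [LinearOrder V] [LinearOrder C] {π : V → C}
    {S S' : Set ((V × V) ⊕ (C × C))} {e : V → Σₗ i, M i} (h : Rz π S e)
    (h1 : ∀ x y, x < y → π x = π y → (Sum.inl (x, y) ∈ S ↔ Sum.inl (x, y) ∈ S'))
    (h2 : ∀ c d, c < d → (Sum.inr (c, d) ∈ S ↔ Sum.inr (c, d) ∈ S')) : Rz π S' e :=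
  ⟨h.1, h.2.1, fun x y hxy hp => (h.2.2.1 x y hxy hp).trans (h1 x y hxy hp),
    fun x y hp => (h.2.2.2 x y hp).trans (h2 _ _ hp)⟩

theorem Rz.cls_lt {V C : Type} [LinearOrder V] [LinearOrder C] {π : V → C} (hπ : Monotone π)
    {S : Set ((V × V) ⊕ (C × C))} {e : V → Σₗ i, M i} (h : Rz π S e) {x y : V}
    (hlt : cls (e x) < cls (e y)) : π x < π y := by
  refine lt_of_le_of_ne (hπ ?_) (fun h3 => hlt.ne ((h.2.1 x y).2 h3))
  exact (h.1.lt_iff_lt.1 (lt_of_cls_lt hlt)).le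

theorem Rz.same (hI : IsRandomOrderedGraph I) (hM : ∀ i, IsRandomOrderedGraph (M i))
    {V C : Type} [LinearOrder V] [LinearOrder C] {π : V → C}
    (hπ : Monotone π) {S : Set ((V × V) ⊕ (C × C))} {e e' : V → Σₗ i, M i}
    (h : Rz π S e) (h' : Rz π S e') {n : ℕ} (j : Fin n → V) :
    SameQfTp (langSD langGr langGr) (Σₗ i, M i) (e ∘ j) (e' ∘ j) := by
  refine sd_same hI hM ?_ ?_ ?_ ?_
  · intro s t
    simp only [Function.comp_apply]
    rw [h.1.lt_iff_lt, h'.1.lt_iff_lt]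
  · intro s t
    simp only [Function.comp_apply]
    rw [h.2.1, h'.2.1]
  · intro s t hlt hc
    simp only [Function.comp_apply] at *
    have hlt := h.1.lt_iff_lt.1 hlt
    have hc := (h.2.1 _ _).1 hc
    rw [h.2.2.1 _ _ hlt hc, h'.2.2.1 _ _ hlt hc]
  · intro s t hlt
    simp only [Function.comp_apply] at *
    have hlt := h.cls_lt hπ hlt
    rw [h.2.2.2 _ _ hlt, h'.2.2.2 _ _ hlt]

theorem lex_finite (A B : Type) [Finite A] [Finite B] : Finite (A ×ₗ B) :=
  inferInstanceAs (Finite (A × B))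

open Classical in
theorem shatter_inl (hI : IsRandomOrderedGraph I) (hM : ∀ i, IsRandomOrderedGraph (M i))
    {V C K : Type} [Finite V] [Finite C] [Finite K] [LinearOrder V] [LinearOrder C]
    [LinearOrder K] {π : V → C}
    (hπ : Monotone π) (S : Set ((V × V) ⊕ (C × C))) (x y : V) (hxy : x < y)
    (hz : Sum.inl (x, y) ∉ S) (mem : K → K → Prop) :
    ∃ e' : V → K → Σₗ i, M i, ∀ k k' : K,
      Rz π (if mem k k' then insert (Sum.inl (x, y)) S else S)
        (fun v => if v = x then e' v k else e' v k') := by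
  haveI := lex_finite V K
  haveI := lex_finite C (V ×ₗ K)
  let vv : C ×ₗ (V ×ₗ K) → V := fun p => (ofLex (ofLex p).2).1
  let kk : C ×ₗ (V ×ₗ K) → K := fun p => (ofLex (ofLex p).2).2
  obtain ⟨e, h1, h2, h3, h4⟩ := flat_realize hI hM (C ×ₗ (V ×ₗ K)) C (fun p => (ofLex p).1)
    (fun p q h => by
      rcases Prod.Lex.le_iff.1 h with h | h
      · exact h.le
      · exact h.1.le)
    (fun p q => if vv p = x ∧ vv q = y then mem (kk p) (kk q) else Sum.inl (vv p, vv q) ∈ S)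
    (fun c c' => Sum.inr (c, c') ∈ S)
  let f : V → K → C ×ₗ (V ×ₗ K) := fun v k => toLex (π v, toLex (v, k))
  have hf : ∀ v v' k k', v < v' → f v k < f v' k' := by
    intro v v' k k' h
    rw [Prod.Lex.lt_iff]
    rcases (hπ h.le).lt_or_eq with h' | h'
    · exact Or.inl h'
    · refine Or.inr ⟨h', ?_⟩
      exact Prod.Lex.lt_iff.2 (Or.inl h)
  refine ⟨fun v k => e (f v k), fun k k' => ?_⟩
  let g : V → C ×ₗ (V ×ₗ K) := fun v => f v (if v = x then k else k')
  have hg : (fun v => if v = x then e (f v k) else e (f v k')) = fun v => e (g v) := by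
    funext v
    by_cases h : v = x <;> simp [g, h]
  show Rz π _ (fun v => if v = x then e (f v k) else e (f v k'))
  rw [hg]
  refine ⟨fun v v' h => h1 (hf _ _ _ _ h), fun v v' => h2 _ _, ?_, ?_⟩
  · intro v v' hlt hp
    refine (h3 (g v) (g v') (hf _ _ _ _ hlt) hp).trans ?_
    show (if v = x ∧ v' = y then mem (if v = x then k else k') (if v' = x then k else k')
      else Sum.inl (v, v') ∈ S) ↔ _
    by_cases hc : v = x ∧ v' = y
    · obtain ⟨rfl, rfl⟩ := hc
      simp only [hlt.ne', and_self, if_true, if_false]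
      by_cases hm : mem k k'
      · simp [hm]
      · simp [hm, hz]
    · rw [if_neg hc]
      by_cases hm : mem k k'
      · rw [if_pos hm, Set.mem_insert_iff]
        simp only [Sum.inl.injEq, Prod.mk.injEq, hc, false_or]
      · rw [if_neg hm]
  · intro v v' hp
    refine (h4 (g v) (g v') hp).trans ?_
    show Sum.inr (π v, π v') ∈ S ↔ _
    by_cases hm : mem k k'
    · simp [hm]
    · simp [hm]

open Classical in
theorem shatter_inr (hI : IsRandomOrderedGraph I) (hM : ∀ i, IsRandomOrderedGraph (M i))
    {V C K : Type} [Finite V] [Finite C] [Finite K] [LinearOrder V] [LinearOrder C]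
    [LinearOrder K] {π : V → C}
    (hπ : Monotone π) (S : Set ((V × V) ⊕ (C × C))) (x y : C) (hxy : x < y)
    (hz : Sum.inr (x, y) ∉ S) (mem : K → K → Prop) :
    ∃ e' : V → K → Σₗ i, M i, ∀ k k' : K,
      Rz π (if mem k k' then insert (Sum.inr (x, y)) S else S)
        (fun v => if π v = x then e' v k else e' v k') := by
  haveI := lex_finite C K
  haveI := lex_finite (C ×ₗ K) V
  obtain ⟨e, h1, h2, h3, h4⟩ := flat_realize hI hM ((C ×ₗ K) ×ₗ V) (C ×ₗ K) (fun p => (ofLex p).1)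
    (fun p q h => by
      rcases Prod.Lex.le_iff.1 h with h | h
      · exact h.le
      · exact h.1.le)
    (fun p q => Sum.inl ((ofLex p).2, (ofLex q).2) ∈ S)
    (fun c c' => if (ofLex c).1 = x ∧ (ofLex c').1 = y then mem (ofLex c).2 (ofLex c').2 else
      Sum.inr ((ofLex c).1, (ofLex c').1) ∈ S)
  let f : V → K → (C ×ₗ K) ×ₗ V := fun v k => toLex (toLex (π v, k), v)
  refine ⟨fun v k => e (f v k), fun k k' => ?_⟩
  let κ : C → K := fun c => if c = x then k else k'
  let g : V → (C ×ₗ K) ×ₗ V := fun v => f v (κ (π v))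
  have hg : (fun v => if π v = x then e (f v k) else e (f v k')) = fun v => e (g v) := by
    funext v
    by_cases h : π v = x <;> simp [g, κ, h]
  show Rz π _ (fun v => if π v = x then e (f v k) else e (f v k'))
  rw [hg]
  have hlt1 : ∀ v v', π v < π v' → (ofLex (g v)).1 < (ofLex (g v')).1 :=
    fun v v' h => Prod.Lex.lt_iff.2 (Or.inl h)
  have heq1 : ∀ v v', π v = π v' → (ofLex (g v)).1 = (ofLex (g v')).1 := by
    intro v v' h
    show toLex (π v, κ (π v)) = toLex (π v', κ (π v'))
    rw [h]
  have hg1 : StrictMono g := by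
    intro v v' h
    rw [Prod.Lex.lt_iff]
    rcases (hπ h.le).lt_or_eq with h' | h'
    · exact Or.inl (hlt1 _ _ h')
    · exact Or.inr ⟨heq1 _ _ h', h⟩
  refine ⟨fun v v' h => h1 (hg1 h), fun v v' => ?_, ?_, ?_⟩
  · rw [h2]
    refine ⟨fun h => ?_, heq1 v v'⟩
    exact congrArg (fun p : C ×ₗ K => (ofLex p).1) h
  · intro v v' hlt hp
    refine (h3 (g v) (g v') (hg1 hlt) (heq1 _ _ hp)).trans ?_
    show Sum.inl (v, v') ∈ S ↔ _
    by_cases hm : mem k k'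
    · simp [hm]
    · simp [hm]
  · intro v v' hp
    refine (h4 (g v) (g v') (hlt1 _ _ hp)).trans ?_
    show (if π v = x ∧ π v' = y then mem (κ (π v)) (κ (π v'))
      else Sum.inr (π v, π v') ∈ S) ↔ _
    by_cases hc : π v = x ∧ π v' = y
    · rw [if_pos hc, hc.1, hc.2]
      simp only [κ, hxy.ne', if_true, if_false]
      by_cases hm : mem k k'
      · simp [hm]
      · simp [hm, hz]
    · rw [if_neg hc]
      by_cases hm : mem k k'
      · rw [if_pos hm, Set.mem_insert_iff]
        simp only [Sum.inr.injEq, Prod.mk.injEq, hc, false_or]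
      · rw [if_neg hm]

open Classical in
theorem ip_of_flip (hI : IsRandomOrderedGraph I) (hM : ∀ i, IsRandomOrderedGraph (M i))
    {L : FirstOrder.Language.{u, v}} {T : L.Theory} (U : Theory.ModelType.{u, v, w'} T)
    {d : ℕ} (X : (Σₗ i, M i) → Fin d → U)
    {V C : Type} [Finite V] [Finite C] [LinearOrder V] [LinearOrder C] {π : V → C}
    (hπ : Monotone π) (S : Set ((V × V) ⊕ (C × C))) (z : (V × V) ⊕ (C × C)) {n : ℕ}
    (j : Fin n → V) (χ : L.Formula (Fin n × Fin d))
    (h1 : ∀ e, Rz π (insert z S) e → χ.Realize fun p => X (e (j p.1)) p.2)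
    (h0 : ∀ e, Rz π S e → ¬ χ.Realize fun p => X (e (j p.1)) p.2) : HasIP L T := by
  have hz : z ∉ S := by
    intro hz
    obtain ⟨e, he⟩ := Rz.exists (M := M) hI hM hπ S
    exact h0 e he (h1 e (by rwa [Set.insert_eq_of_mem hz]))
  have hQ : ∃ Q : V → Prop, ∀ (K : Type) [Finite K] [LinearOrder K] (mem : K → K → Prop),
      ∃ e' : V → K → Σₗ i, M i, ∀ k k' : K, Rz π (if mem k k' then insert z S else S)
        (fun v => if Q v then e' v k else e' v k') := by
    rcases z with ⟨x, y⟩ | ⟨x, y⟩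
    · by_cases hxy : x < y
      · exact ⟨fun v => v = x, fun K _ _ mem => by
          obtain ⟨e', he'⟩ := shatter_inl (M := M) hI hM hπ S x y hxy hz mem
          refine ⟨e', fun k k' => ?_⟩
          convert he' k k'⟩
      · exfalso
        obtain ⟨e, he⟩ := Rz.exists (M := M) hI hM hπ S
        refine h0 e he (h1 e (he.congr ?_ ?_))
        · intro a b hab _
          rw [Set.mem_insert_iff]
          have : ¬ (a = x ∧ b = y) := by rintro ⟨rfl, rfl⟩; exact hxy hab
          simp [this]
        · intro c d hcd
          simp
    · by_cases hxy : x < y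
      · exact ⟨fun v => π v = x, fun K _ _ mem => by
          obtain ⟨e', he'⟩ := shatter_inr (M := M) hI hM hπ S x y hxy hz mem
          refine ⟨e', fun k k' => ?_⟩
          convert he' k k'⟩
      · exfalso
        obtain ⟨e, he⟩ := Rz.exists (M := M) hI hM hπ S
        refine h0 e he (h1 e (he.congr ?_ ?_))
        · intro a b hab _
          simp
        · intro a b hab
          rw [Set.mem_insert_iff]
          have : ¬ (a = x ∧ b = y) := by rintro ⟨rfl, rfl⟩; exact hxy hab
          simp [this]
  obtain ⟨Q, hQ⟩ := hQ
  refine ip_of_shatter T U χ (fun w => Q (j w.1)) fun r => ?_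
  obtain ⟨m, ⟨eq⟩⟩ := Finite.exists_equiv_fin (Fin r ⊕ Set (Fin r))
  obtain ⟨e', he'⟩ := hQ (Fin m) (fun k k' => ∃ i S, eq.symm k = Sum.inl i ∧
    eq.symm k' = Sum.inr S ∧ i ∈ S)
  refine ⟨fun i w => X (e' (j w.1) (eq (Sum.inl i))) w.2,
    fun S w => X (e' (j w.1) (eq (Sum.inr S))) w.2, fun i S' => ?_⟩
  have h := he' (eq (Sum.inl i)) (eq (Sum.inr S'))
  have hm : (∃ i' S, eq.symm (eq (Sum.inl i)) = Sum.inl i' ∧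
    eq.symm (eq (Sum.inr S')) = Sum.inr S ∧ i' ∈ S) ↔ i ∈ S' := by
    simp
  have hfun : (fun w : Fin n × Fin d => if Q (j w.1) then X (e' (j w.1) (eq (Sum.inl i))) w.2
      else X (e' (j w.1) (eq (Sum.inr S'))) w.2) = fun w =>
      X ((fun v => if Q v then e' v (eq (Sum.inl i)) else e' v (eq (Sum.inr S'))) (j w.1)) w.2 := by
    funext w
    by_cases hw : Q (j w.1) <;> simp [hw]
  rw [hfun]
  by_cases hi : i ∈ S'
  · rw [if_pos (hm.2 hi)] at h
    exact iff_of_true (h1 _ h) hi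
  · rw [if_neg (fun h => hi (hm.1 h))] at h
    exact iff_of_false (h0 _ h) hi

theorem ip_of_differ (hI : IsRandomOrderedGraph I) (hM : ∀ i, IsRandomOrderedGraph (M i))
    {L : FirstOrder.Language.{u, v}} {T : L.Theory} (U : Theory.ModelType.{u, v, w'} T)
    {d : ℕ} (X : (Σₗ i, M i) → Fin d → U)
    (hX : IndexedIndiscernible (langSD langGr langGr) (Σₗ i, M i) L U d X)
    {V C : Type} [Finite V] [Finite C] [LinearOrder V] [LinearOrder C] {π : V → C}
    (hπ : Monotone π) {S S' : Set ((V × V) ⊕ (C × C))} {n : ℕ}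
    (j : Fin n → V) (φ : L.Formula (Fin n × Fin d)) {e e' : V → Σₗ i, M i}
    (he : Rz π S e) (he' : Rz π S' e')
    (hd : ¬ ((φ.Realize fun p => X (e (j p.1)) p.2) ↔ (φ.Realize fun p => X (e' (j p.1)) p.2))) :
    HasIP L T := by
  classical
  let τ : Set ((V × V) ⊕ (C × C)) → Prop := fun S =>
    ∃ e : V → Σₗ i, M i, Rz π S e ∧ φ.Realize fun p => X (e (j p.1)) p.2
  have hτ : ∀ S (e : V → Σₗ i, M i), Rz π S e →
      (τ S ↔ φ.Realize fun p => X (e (j p.1)) p.2) := by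
    intro S e he
    constructor
    · rintro ⟨e1, he1, h⟩
      exact (hX n (e1 ∘ j) (e ∘ j) (he1.same hI hM hπ he j) φ).1 h
    · exact fun h => ⟨e, he, h⟩
  by_cases hall : ∀ S z, τ (insert z S) ↔ τ S
  · exfalso
    have hconst : ∀ S, τ S ↔ τ ∅ := by
      intro S
      refine Set.Finite.induction_on S (Set.toFinite S) Iff.rfl ?_
      intro a s _ _ ih
      exact (hall s a).trans ih
    apply hd
    rw [← hτ S e he, ← hτ S' e' he', hconst S, hconst S']
  · push Not at hall
    obtain ⟨S, z, hSz⟩ := hall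
    rcases hSz with ⟨h1, h0⟩ | ⟨h1, h0⟩
    · exact ip_of_flip hI hM U X hπ S z j φ (fun e he => (hτ _ e he).1 h1)
        (fun e he h => h0 ((hτ _ e he).2 h))
    · refine ip_of_flip hI hM U X hπ S z j φ.not (fun e he => ?_) (fun e he => ?_)
      · rw [Formula.realize_not]
        exact fun h => h1 ((hτ _ e he).2 h)
      · rw [Formula.realize_not, not_not]
        exact (hτ _ e he).1 h0

theorem nip_collapse (hI : IsRandomOrderedGraph I) (hM : ∀ i, IsRandomOrderedGraph (M i))
    {L : FirstOrder.Language.{u, v}} {T : L.Theory} (hnip : ¬ HasIP L T)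
    (U : Theory.ModelType.{u, v, w'} T)
    {d : ℕ} (X : (Σₗ i, M i) → Fin d → U)
    (hX : IndexedIndiscernible (langSD langGr langGr) (Σₗ i, M i) L U d X) :
    IndexedIndiscernible langEO (Σₗ i, M i) L U d X := by
  intro n ι κ hs φ
  by_contra hd
  apply hnip
  let π : Set.range ι → Set.range (fun r => cls (ι r)) := fun v => ⟨cls v.1, by
    obtain ⟨r, hr⟩ := v.2
    exact ⟨r, congrArg cls hr⟩⟩
  have hπ : Monotone π := fun v v' h => cls_mono (show v.1 ≤ v'.1 from h)
  have hπe : ∀ v v', π v = π v' ↔ cls v.1 = cls v'.1 := fun v v' => Subtype.ext_iff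
  choose sec hsec using fun v : Set.range ι => v.2
  let e' : Set.range ι → Σₗ i, M i := fun v => κ (sec v)
  have hcl : ∀ x y, cls (e' x) = cls (e' y) ↔ π x = π y := by
    intro x y
    rw [hπe, ← (eo_data hs (sec x) (sec y)).1, hsec, hsec]
  let S : Set ((Set.range ι × Set.range ι) ⊕
      (Set.range (fun r => cls (ι r)) × Set.range (fun r => cls (ι r)))) :=
    {z | Sum.elim (fun p => r1 p.1.1 p.2.1) (fun p => gadj p.1.1 p.2.1) z}
  let S' : Set ((Set.range ι × Set.range ι) ⊕
      (Set.range (fun r => cls (ι r)) × Set.range (fun r => cls (ι r)))) :=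
    {z | Sum.elim (fun p => r1 (e' p.1) (e' p.2))
      (fun p => ∃ x y, π x = p.1 ∧ π y = p.2 ∧ gadj (cls (e' x)) (cls (e' y))) z}
  have hS : Rz π S (fun v => v.1) :=
    ⟨fun v v' h => h, fun v v' => (hπe v v').symm, fun _ _ _ _ => Iff.rfl, fun _ _ _ => Iff.rfl⟩
  have hS' : Rz π S' e' := by
    refine ⟨?_, hcl, fun _ _ _ _ => Iff.rfl, ?_⟩
    · intro v v' h
      apply (eo_data hs (sec v) (sec v')).2.1
      rw [hsec, hsec]
      exact h
    · intro x y _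
      show _ ↔ ∃ x' y', π x' = π x ∧ π y' = π y ∧ gadj (cls (e' x')) (cls (e' y'))
      constructor
      · exact fun h => ⟨x, y, rfl, rfl, h⟩
      · rintro ⟨x', y', h1, h2, h⟩
        rwa [(hcl _ _).2 h1, (hcl _ _).2 h2] at h
  let j : Fin n → Set.range ι := fun r => ⟨ι r, r, rfl⟩
  have hj : ∀ r, e' (j r) = κ r := by
    intro r
    have h1 : ι (sec (j r)) = ι r := hsec (j r)
    have h2 := (eo_data hs (sec (j r)) r).2
    have h3 := (eo_data hs r (sec (j r))).2
    rw [h1] at h2 h3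
    simp only [lt_self_iff_false, false_iff, not_lt] at h2 h3
    exact le_antisymm h3 h2
  refine ip_of_differ hI hM U X hX hπ j φ hS hS' ?_
  simp only [hj]
  exact hd

end Main
end SRPaper

open SRPaper in
/-- Let `𝓘` be a random ordered graph, each `M_i` a random ordered graph,
`R = 𝓘_{i ∈ I}(M_i)` the semi-direct product (in the language `{E, R1, R2, <}`) and `O` its
reduct to `{E, <}`.  Then a complete theory `T` is NIP iff every `R`-indexed indiscernible
set of tuples in a (sufficiently saturated) model of `T` is an `O`-indexed indiscernible
set. -/
theorem statement17 (I : Type) [langGr.Structure I] [LinearOrder I] [Countable I]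
    (hI : IsRandomOrderedGraph I)
    (M : I → Type) [∀ i, langGr.Structure (M i)] [∀ i, LinearOrder (M i)]
    [∀ i, Countable (M i)] (hM : ∀ i, IsRandomOrderedGraph (M i))
    (L : FirstOrder.Language.{u, v}) (T : L.Theory) (hT : T.IsComplete) :
    ¬ HasIP L T ↔
      ∀ (U : Theory.ModelType.{u, v, max u v} T) (_ : AlephOneSaturated L U) (d : ℕ)
        (X : (Σₗ i, M i) → Fin d → U),
        IndexedIndiscernible (langSD langGr langGr) (Σₗ i, M i) L U d X →
        IndexedIndiscernible langEO (Σₗ i, M i) L U d X := by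
  constructor
  · intro hnip U _ d X hX
    exact SRPaper.nip_collapse hI hM hnip U X hX
  · intro h hip
    obtain ⟨U, hU, d, X, h1, h2⟩ := SRPaper.ip_not_collapse hI hM L T hip
    exact h2 (h U hU d X h1)
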